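/- arXiv:2103.03777 — 3 statements merged into one kernel-verified Lean document; each statement's English description precedes it below -/
import Mathlib

section
/- For every prime power q with q > 2, the group PSL(3,q), i.e. the quotient of SL(3, F_q) by its center, is not strongly symmetric: there exist x, y generating PSL(3,q) such that no automorphism φ of PSL(3,q) satisfies φ(x) = x⁻¹ and φ(y) = y⁻¹. -/
/-- A pair `(x, y)` of elements of a group `G` is a *symmetric generating pair* if it
generates `G` and some automorphism of `G` inverts both `x` and `y`.  A group `G` is
*strongly symmetric* if it can be generated by two elements and every generating pair
is symmetric. -/
def StronglySymmetric (G : Type*) [Group G] : Prop :=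
  (∃ x y : G, Subgroup.closure {x, y} = ⊤) ∧
    ∀ x y : G, Subgroup.closure {x, y} = ⊤ →
      ∃ φ : MulAut G, φ x = x⁻¹ ∧ φ y = y⁻¹

namespace PSL3
open Matrix
variable {F : Type*} [Field F]

local notation "SL3" => Matrix.SpecialLinearGroup (Fin 3)

def E12 (t : F) : SL3 F := ⟨!![1,t,0;0,1,0;0,0,1], by simp [Matrix.det_fin_three]⟩
def E13 (t : F) : SL3 F := ⟨!![1,0,t;0,1,0;0,0,1], by simp [Matrix.det_fin_three]⟩
def E23 (t : F) : SL3 F := ⟨!![1,0,0;0,1,t;0,0,1], by simp [Matrix.det_fin_three]⟩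
def E21 (t : F) : SL3 F := ⟨!![1,0,0;t,1,0;0,0,1], by simp [Matrix.det_fin_three]⟩
def E31 (t : F) : SL3 F := ⟨!![1,0,0;0,1,0;t,0,1], by simp [Matrix.det_fin_three]⟩
def E32 (t : F) : SL3 F := ⟨!![1,0,0;0,1,0;0,t,1], by simp [Matrix.det_fin_three]⟩
/-- The cyclic permutation matrix `e₁ ↦ e₂ ↦ e₃ ↦ e₁`. -/
def cyc : SL3 F := ⟨!![0,0,1;1,0,0;0,1,0], by simp [Matrix.det_fin_three]⟩

theorem sl_ext {A B : SL3 F} (h : (A : Matrix (Fin 3) (Fin 3) F) = B) : A = B := Subtype.ext h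

/-- Subgroup containing all transvections is everything. -/
theorem top_of_all (H : Subgroup (SL3 F))
    (h12 : ∀ t, E12 t ∈ H) (h13 : ∀ t, E13 t ∈ H) (h23 : ∀ t, E23 t ∈ H)
    (h21 : ∀ t, E21 t ∈ H) (h31 : ∀ t, E31 t ∈ H) (h32 : ∀ t, E32 t ∈ H) : H = ⊤ := by
  classical
  have htr : ∀ s : TransvectionStruct (Fin 3) F, s.toSpecialLinearGroup ∈ H := by
    rintro ⟨i, j, hij, c⟩
    have key : ∀ A : SL3 F, A ∈ H → (A : Matrix (Fin 3) (Fin 3) F) = Matrix.transvection i j c →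
        (TransvectionStruct.mk i j hij c).toSpecialLinearGroup ∈ H := by
      intro A hA h
      have : (TransvectionStruct.mk i j hij c).toSpecialLinearGroup = A := by
        apply sl_ext; rw [h]; rfl
      rwa [this]
    fin_cases i <;> fin_cases j <;> first | exact absurd rfl hij | skip
    · exact key _ (h12 c) (by ext i j; fin_cases i <;> fin_cases j <;> simp [E12, Matrix.transvection])
    · exact key _ (h13 c) (by ext i j; fin_cases i <;> fin_cases j <;> simp [E13, Matrix.transvection])
    · exact key _ (h21 c) (by ext i j; fin_cases i <;> fin_cases j <;> simp [E21, Matrix.transvection])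
    · exact key _ (h23 c) (by ext i j; fin_cases i <;> fin_cases j <;> simp [E23, Matrix.transvection])
    · exact key _ (h31 c) (by ext i j; fin_cases i <;> fin_cases j <;> simp [E31, Matrix.transvection])
    · exact key _ (h32 c) (by ext i j; fin_cases i <;> fin_cases j <;> simp [E32, Matrix.transvection])
  have hlist : ∀ L : List (TransvectionStruct (Fin 3) F), ∃ A ∈ H,
      (A : Matrix (Fin 3) (Fin 3) F) = (L.map TransvectionStruct.toMatrix).prod := by
    intro L
    induction L with
    | nil => exact ⟨1, H.one_mem, by simp⟩
    | cons s L ih =>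
      obtain ⟨A, hA, h⟩ := ih
      exact ⟨s.toSpecialLinearGroup * A, H.mul_mem (htr s) hA, by simp [h]⟩
  have hd1 : ∀ (a : F), a ≠ 0 → ∃ A ∈ H, (A : Matrix (Fin 3) (Fin 3) F) = !![a,0,0;0,a⁻¹,0;0,0,1] := by
    intro a ha
    refine ⟨E12 a * E21 (-a⁻¹) * E12 a * (E12 (-1) * E21 1 * E12 (-1)), ?_, ?_⟩
    · exact H.mul_mem (H.mul_mem (H.mul_mem (h12 _) (h21 _)) (h12 _))
        (H.mul_mem (H.mul_mem (h12 _) (h21 _)) (h12 _))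
    · simp only [Matrix.SpecialLinearGroup.coe_mul]
      simp [E12, E21, ha]
  have hd2 : ∀ (a : F), a ≠ 0 → ∃ A ∈ H, (A : Matrix (Fin 3) (Fin 3) F) = !![1,0,0;0,a,0;0,0,a⁻¹] := by
    intro a ha
    refine ⟨E23 a * E32 (-a⁻¹) * E23 a * (E23 (-1) * E32 1 * E23 (-1)), ?_, ?_⟩
    · exact H.mul_mem (H.mul_mem (H.mul_mem (h23 _) (h32 _)) (h23 _))
        (H.mul_mem (H.mul_mem (h23 _) (h32 _)) (h23 _))
    · simp only [Matrix.SpecialLinearGroup.coe_mul]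
      simp [E23, E32, ha]
  rw [eq_top_iff]
  intro M _
  obtain ⟨L, L', D, h⟩ := Matrix.Pivot.exists_list_transvec_mul_diagonal_mul_list_transvec
    (M : Matrix (Fin 3) (Fin 3) F)
  have hdet : D 0 * D 1 * D 2 = 1 := by
    have := congrArg Matrix.det h
    simpa [Matrix.det_mul, Fin.prod_univ_three] using this.symm
  have h0 : D 0 ≠ 0 := by rintro h; simp [h] at hdet
  have h1 : D 1 ≠ 0 := by rintro h; simp [h] at hdet
  have h2 : D 2 = (D 0 * D 1)⁻¹ := by
    exact (inv_eq_of_mul_eq_one_right hdet).symm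
  obtain ⟨A, hA, eA⟩ := hlist L
  obtain ⟨B, hB, eB⟩ := hlist L'
  obtain ⟨P, hP, eP⟩ := hd1 (D 0) h0
  obtain ⟨Q, hQ, eQ⟩ := hd2 (D 0 * D 1) (mul_ne_zero h0 h1)
  have hdiag : Matrix.diagonal D = (P * Q : Matrix (Fin 3) (Fin 3) F) := by
    rw [eP, eQ]
    ext i j
    fin_cases i <;> fin_cases j <;> simp [h0, h2, Matrix.mul_apply, Fin.sum_univ_three]
  have : M = A * (P * Q) * B := by
    apply sl_ext
    rw [h, hdiag, ← eA, ← eB]; simp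
  rw [this]
  exact H.mul_mem (H.mul_mem hA (H.mul_mem hP hQ)) hB

theorem cyc_E13 (t : F) : cyc * E13 t = E21 t * cyc := by
  apply sl_ext; simp only [Matrix.SpecialLinearGroup.coe_mul]; simp [cyc, E13, E21]
theorem cyc_E21 (t : F) : cyc * E21 t = E32 t * cyc := by
  apply sl_ext; simp only [Matrix.SpecialLinearGroup.coe_mul]; simp [cyc, E32, E21]
theorem cyc_E32 (t : F) : cyc * E32 t = E13 t * cyc := by
  apply sl_ext; simp only [Matrix.SpecialLinearGroup.coe_mul]; simp [cyc, E32, E13]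
theorem cyc_E12 (t : F) : cyc * E12 t = E23 t * cyc := by
  apply sl_ext; simp only [Matrix.SpecialLinearGroup.coe_mul]; simp [cyc, E12, E23]
theorem cyc_E23 (t : F) : cyc * E23 t = E31 t * cyc := by
  apply sl_ext; simp only [Matrix.SpecialLinearGroup.coe_mul]; simp [cyc, E23, E31]
theorem comm_13_32 (t s : F) : E13 t * E32 s = E12 (t * s) * (E32 s * E13 t) := by
  apply sl_ext; simp only [Matrix.SpecialLinearGroup.coe_mul]; simp [E13, E32, E12]
theorem comm_13_21 (t s : F) : E13 t * E21 s = E23 (-(t * s)) * (E21 s * E13 t) := by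
  apply sl_ext; simp only [Matrix.SpecialLinearGroup.coe_mul]; simp [E13, E21, E23, mul_comm]

theorem conj_mem {G : Type*} [Group G] {H : Subgroup G} {c a b : G} (h : c * a = b * c)
    (hc : c ∈ H) (ha : a ∈ H) : b ∈ H := by
  rw [← mul_inv_eq_iff_eq_mul] at h
  rw [← h]
  exact H.mul_mem (H.mul_mem hc ha) (H.inv_mem hc)

theorem comm_mem {G : Type*} [Group G] {H : Subgroup G} {a b c : G} (h : a * b = c * (b * a))
    (ha : a ∈ H) (hb : b ∈ H) : c ∈ H := by
  rw [← mul_inv_eq_iff_eq_mul] at h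
  rw [← h]
  exact H.mul_mem (H.mul_mem ha hb) (H.inv_mem (H.mul_mem hb ha))

theorem top_of_cyc (H : Subgroup (SL3 F)) (hc : cyc ∈ H) (h32 : ∀ t, E32 t ∈ H) : H = ⊤ := by
  have h13 : ∀ t, E13 t ∈ H := fun t => conj_mem (cyc_E32 t) hc (h32 t)
  have h21 : ∀ t, E21 t ∈ H := fun t => conj_mem (cyc_E13 t) hc (h13 t)
  have h12 : ∀ t, E12 t ∈ H := fun t => comm_mem (by simpa only [mul_one] using comm_13_32 t 1) (h13 t) (h32 1)
  have h23 : ∀ t, E23 t ∈ H := fun t => conj_mem (cyc_E12 t) hc (h12 t)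
  have h31 : ∀ t, E31 t ∈ H := fun t => conj_mem (cyc_E23 t) hc (h23 t)
  exact top_of_all H h12 h13 h23 h21 h31 h32

theorem nat_aux {q r : ℕ} (h2 : 2 < q) (h4 : q ≠ 4) (hr : 2 ≤ r) (hc : r * r ≤ q)
    (hle : q - 1 ≤ 3 * (r - 1)) (hdvd : q - 1 ∣ 3 * (r - 1)) : False := by
  have : r ≤ 2 := by
    by_contra hr3
    push Not at hr3
    have : r * r ≥ 3 * r := Nat.mul_le_mul_right r hr3
    omega
  have : r = 2 := by omega
  subst this
  omega

/-- subring generated by the cube of a primitive element -/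
theorem subring_top [Fintype F] (h2 : 2 < Fintype.card F) (h4 : Fintype.card F ≠ 4)
    (a : Fˣ) (ha : ∀ x, x ∈ Subgroup.zpowers a) (K : Subring F) (hK : (a : F) ^ 3 ∈ K) :
    ∀ x, x ∈ K := by
  classical
  let K' : Subfield F := { K with
    inv_mem' := by
      intro x hx
      by_cases h0 : x = 0
      · subst h0; simpa using hx
      · have : x⁻¹ = x ^ (Fintype.card F - 2) := by
          have h := FiniteField.pow_card_sub_one_eq_one x h0
          apply inv_eq_of_mul_eq_one_right
          rw [← pow_succ', ← h]; congr 1; omega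
        rw [this]; exact K.pow_mem hx _ }
  have hK' : (a : F) ^ 3 ∈ K' := hK
  by_contra hne
  push Not at hne
  obtain ⟨z, hz⟩ := hne
  have hz' : z ∉ K' := hz
  have hinj : Function.Injective (fun p : K' × K' => (p.1 : F) + p.2 * z) := by
    rintro ⟨p, p'⟩ ⟨r, r'⟩ h
    simp only at h
    have e : ((p' : F) - r') * z = r - p := by linear_combination h
    by_cases h0 : (p' : F) - r' = 0
    · rw [h0, zero_mul] at e
      ext
      · exact (sub_eq_zero.1 e.symm).symm
      · exact sub_eq_zero.1 h0
    · exfalso; apply hz'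
      have : z = (r - p) / ((p' : F) - r') := by rw [← e]; field_simp
      rw [this]
      exact K'.div_mem (K'.sub_mem r.2 p.2) (K'.sub_mem p'.2 r'.2)
  have hc := Fintype.card_le_of_injective _ hinj
  rw [Fintype.card_prod] at hc
  have hord : orderOf a = Fintype.card F - 1 := by
    rw [orderOf_eq_card_of_forall_mem_zpowers ha, Nat.card_units, Nat.card_eq_fintype_card]
  have hb : ((⟨(a : F) ^ 3, hK'⟩ : K') : K') ≠ 0 := by
    intro h; have := congrArg (Subtype.val) h; simp at this
  have h1 := FiniteField.pow_card_sub_one_eq_one _ hb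
  have h1' : a ^ (3 * (Fintype.card K' - 1)) = 1 := by
    ext; have := congrArg (Subtype.val) h1
    simpa [pow_mul] using this
  have hdvd := orderOf_dvd_of_pow_eq_one h1'
  rw [hord] at hdvd
  have hr : 2 ≤ Fintype.card K' := Fintype.one_lt_card
  have hle := Nat.le_of_dvd (by omega) hdvd
  exact nat_aux h2 h4 hr hc hle hdvd

theorem addSubgroup_top [Fintype F] (h2 : 2 < Fintype.card F) (h4 : Fintype.card F ≠ 4)
    (a : Fˣ) (ha : ∀ x, x ∈ Subgroup.zpowers a) (A : AddSubgroup F)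
    (hA : ∀ t ∈ A, (a : F) ^ 3 * t ∈ A) (t₀ : F) (ht₀ : t₀ ≠ 0) (hm : t₀ ∈ A) (x : F) : x ∈ A := by
  let K : Subring F :=
    { carrier := {k | ∀ t ∈ A, k * t ∈ A}
      mul_mem' := by
        intro k l hk hl t ht; rw [mul_assoc]; exact hk _ (hl _ ht)
      one_mem' := by intro t ht; simpa using ht
      add_mem' := by
        intro k l hk hl t ht; rw [add_mul]; exact A.add_mem (hk _ ht) (hl _ ht)
      zero_mem' := by intro t ht; simp
      neg_mem' := by
        intro k hk t ht; rw [neg_mul]; exact A.neg_mem (hk _ ht) }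
  have := subring_top h2 h4 a ha K hA (x / t₀) t₀ hm
  rwa [div_mul_cancel₀ _ ht₀] at this

/-! ### The generic case -/

def dA (a : Fˣ) : SL3 F :=
  ⟨!![(a : F),0,0;0,a,0;0,0,((a⁻¹ : Fˣ) : F)^2], by simp [Matrix.det_fin_three]; field_simp⟩
/-- conjugate of `dA` by `yA` -/
def dA1 (a : Fˣ) : SL3 F :=
  ⟨!![((a⁻¹ : Fˣ) : F)^2,0,0;0,a,0;0,0,(a : F)], by simp [Matrix.det_fin_three]; field_simp⟩
/-- conjugate of `dA` by the inverse of `yA` -/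
def dA2 (a : Fˣ) : SL3 F :=
  ⟨!![(a : F),0,0;((a⁻¹ : Fˣ) : F)^2 - a,((a⁻¹ : Fˣ) : F)^2,0;0,0,(a : F)],
    by simp [Matrix.det_fin_three]; field_simp⟩
def yA : SL3 F := E32 1 * cyc
def pA : SL3 F := ⟨!![2,0,-1;1,1,-1;1,0,0], by simp [Matrix.det_fin_three]⟩

theorem yA_coe : ((yA : SL3 F) : Matrix (Fin 3) (Fin 3) F) = !![0,0,1;1,0,0;1,1,0] := by
  simp only [yA, Matrix.SpecialLinearGroup.coe_mul]; simp [E32, cyc]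

theorem yA3_coe : ((yA ^ 3 : SL3 F) : Matrix (Fin 3) (Fin 3) F) = !![1,0,1;1,1,0;1,1,1] := by
  simp only [pow_succ, pow_zero, one_mul, Matrix.SpecialLinearGroup.coe_mul, yA_coe]
  simp

theorem yA_dA (a : Fˣ) : yA * dA a = dA1 a * yA := by
  apply sl_ext; simp only [Matrix.SpecialLinearGroup.coe_mul, yA_coe]; simp [dA, dA1]
theorem yA_dA2 (a : Fˣ) : yA * dA2 a = dA a * yA := by
  apply sl_ext; simp only [Matrix.SpecialLinearGroup.coe_mul, yA_coe]; simp [dA, dA2]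
theorem dA1_E21 (a : Fˣ) (t : F) : dA1 a * E21 t = E21 ((a : F) ^ 3 * t) * dA1 a := by
  apply sl_ext; simp only [Matrix.SpecialLinearGroup.coe_mul]; simp [dA1, E21]; field_simp
theorem dA1_dA2 (a : Fˣ) : dA1 a * dA2 a =
    E21 ((((a⁻¹ : Fˣ) : F) ^ 3 - 1) * ((a : F) ^ 3 - 1)) * (dA2 a * dA1 a) := by
  apply sl_ext; simp only [Matrix.SpecialLinearGroup.coe_mul]; simp [dA1, dA2, E21]; field_simp; ring_nf; simp
theorem dA_mul (a b : Fˣ) : dA a * dA b = dA (a * b) := by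
  apply sl_ext; simp only [Matrix.SpecialLinearGroup.coe_mul]; simp [dA]; field_simp
theorem dA_one : dA (1 : Fˣ) = 1 := by
  apply sl_ext; ext i j; fin_cases i <;> fin_cases j <;> simp [dA]
theorem E12_zero : E12 (0 : F) = 1 := by
  apply sl_ext; ext i j; fin_cases i <;> fin_cases j <;> simp [E12]
theorem E12_add (s t : F) : E12 s * E12 t = E12 (s + t) := by
  apply sl_ext; simp only [Matrix.SpecialLinearGroup.coe_mul]; simp [E12, add_comm]
theorem E21_zero : E21 (0 : F) = 1 := by
  apply sl_ext; ext i j; fin_cases i <;> fin_cases j <;> simp [E21]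
theorem E21_add (s t : F) : E21 s * E21 t = E21 (s + t) := by
  apply sl_ext; simp only [Matrix.SpecialLinearGroup.coe_mul]; simp [E21]
theorem E12_dA (a : Fˣ) (t : F) : E12 t * dA a = dA a * E12 t := by
  apply sl_ext; simp only [Matrix.SpecialLinearGroup.coe_mul]; simp [dA, E12, mul_comm]

def xA (a : Fˣ) : SL3 F := E12 1 * dA a

theorem xA_pow (a : Fˣ) (n : ℕ) : xA a ^ n = E12 (n : F) * dA (a ^ n) := by
  induction n with
  | zero => simp [dA_one, E12_zero]
  | succ n ih =>
    rw [pow_succ, ih, xA]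
    calc E12 (n : F) * dA (a ^ n) * (E12 1 * dA a)
        = E12 (n : F) * (dA (a ^ n) * E12 1) * dA a := by simp only [mul_assoc]
      _ = (E12 (n : F) * E12 1) * (dA (a ^ n) * dA a) := by
          rw [← E12_dA]; simp only [mul_assoc]
      _ = _ := by rw [E12_add, dA_mul, pow_succ]; push_cast; rfl

theorem xA_pow_card [Fintype F] (a : Fˣ) : xA a ^ Fintype.card F = dA a := by
  rw [xA_pow, FiniteField.cast_card_eq_zero, E12_zero, one_mul]
  congr 1; ext; simp [FiniteField.pow_card]

theorem xA_pow_card_sub [Fintype F] (a : Fˣ) : xA a ^ (Fintype.card F - 1) = E12 (-1) := by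
  rw [xA_pow]
  have h1 : a ^ (Fintype.card F - 1) = 1 := by
    ext; simp [FiniteField.pow_card_sub_one_eq_one _ a.ne_zero]
  have h2 : ((Fintype.card F - 1 : ℕ) : F) = -1 := by
    rw [Nat.cast_sub Fintype.card_pos, FiniteField.cast_card_eq_zero]; simp
  rw [h1, h2, dA_one, mul_one]

theorem yA_E12 : yA ^ 3 * E12 (-1 : F) = pA * yA ^ 3 := by
  apply sl_ext; simp only [Matrix.SpecialLinearGroup.coe_mul, yA3_coe]; simp [pA, E12]
  norm_num

theorem commA (a : Fˣ) : Commute (E12 (-1 : F)) (yA ^ 3 * dA a * (yA ^ 3)⁻¹) := by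
  let w : SL3 F := ⟨!![(a : F),a-(a⁻¹ : F)^2,(a⁻¹ : F)^2-a;0,a,0;0,a-(a⁻¹ : F)^2,(a⁻¹ : F)^2], by
    simp [Matrix.det_fin_three]; field_simp⟩
  have : yA ^ 3 * dA a * (yA ^ 3)⁻¹ = w := by
    rw [mul_inv_eq_iff_eq_mul]
    apply sl_ext; simp only [Matrix.SpecialLinearGroup.coe_mul, yA3_coe]; simp [w, dA]
  rw [this]
  apply sl_ext; simp only [Matrix.SpecialLinearGroup.coe_mul]; simp [w, E12]
  ring

theorem genA [Fintype F] (h2 : 2 < Fintype.card F) (h4 : Fintype.card F ≠ 4)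
    (a : Fˣ) (ha : ∀ x, x ∈ Subgroup.zpowers a) (ha3 : (a : F) ^ 3 ≠ 1) :
    Subgroup.closure {xA a, yA} = ⊤ := by
  set H := Subgroup.closure {xA a, yA} with hH
  have hx : xA a ∈ H := Subgroup.subset_closure (by simp)
  have hy : yA ∈ H := Subgroup.subset_closure (by simp)
  have hd : dA a ∈ H := by rw [← xA_pow_card]; exact H.pow_mem hx _
  have hd1 : dA1 a ∈ H := conj_mem (yA_dA a) hy hd
  have hd2 : dA2 a ∈ H := by
    have : dA2 a = yA⁻¹ * (dA a * yA) := by rw [← yA_dA2]; simp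
    rw [this]
    exact H.mul_mem (H.inv_mem hy) (H.mul_mem hd hy)
  have h0 := comm_mem (dA1_dA2 a) hd1 hd2
  let A : AddSubgroup F :=
    { carrier := {t | E21 t ∈ H}
      add_mem' := by
        intro s t hs ht
        simp only [Set.mem_ofPred_eq] at *
        rw [← E21_add]; exact H.mul_mem hs ht
      zero_mem' := by simp only [Set.mem_ofPred_eq]; rw [E21_zero]; exact H.one_mem
      neg_mem' := by
        intro t ht
        simp only [Set.mem_ofPred_eq] at *
        have : E21 (-t) = (E21 t)⁻¹ := by
          apply eq_inv_of_mul_eq_one_left; rw [E21_add]; simp [E21_zero]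
        rw [this]; exact H.inv_mem ht }
  have h21 : ∀ t, E21 t ∈ H := by
    intro t
    refine addSubgroup_top h2 h4 a ha A ?_ _ ?_ h0 t
    · intro t ht
      exact conj_mem (dA1_E21 a t) hd1 ht
    · apply mul_ne_zero
      · rw [sub_ne_zero]; intro h; apply ha3
        simpa using h
      · exact sub_ne_zero.2 ha3
  have h32 : ∀ t, E32 t ∈ H := by
    intro t
    refine conj_mem (c := yA) (a := E21 t) ?_ hy (h21 t)
    apply sl_ext; simp only [Matrix.SpecialLinearGroup.coe_mul, yA_coe]; simp [E21, E32, add_comm]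
  refine top_of_cyc H ?_ h32
  have : (cyc : SL3 F) = (E32 1)⁻¹ * yA := by simp [yA]
  rw [this]
  exact H.mul_mem (H.inv_mem (h32 1)) hy

theorem group_aux {G : Type*} [Group G] (φ : MulAut G) (x y : G) (m n : ℕ) (hx : φ x = x⁻¹)
    (hy : φ y = y⁻¹) (h : Commute (x ^ m) (y ^ 3 * x ^ n * (y ^ 3)⁻¹)) :
    Commute (y ^ 3 * x ^ m * (y ^ 3)⁻¹) (x ^ n) := by
  have h' := h.map φ
  simp only [map_mul, map_pow, map_inv, hx, hy, inv_pow, inv_inv] at h'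
  generalize x ^ m = v at *
  generalize x ^ n = d at *
  generalize y ^ 3 = c at *
  have h1 : Commute v (c⁻¹ * d * c) := by
    have := h'.inv_inv
    simpa [mul_assoc] using this
  have := h1.map (MulAut.conj c)
  simpa [mul_assoc] using this

theorem mk_eq {A B : SL3 F}
    (h : (A : Matrix.ProjectiveSpecialLinearGroup (Fin 3) F) = B) :
    ∃ r : F, ∀ i j, (B : Matrix (Fin 3) (Fin 3) F) i j = r * (A : Matrix (Fin 3) (Fin 3) F) i j := by
  rw [QuotientGroup.eq, Matrix.SpecialLinearGroup.mem_center_iff] at h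
  obtain ⟨r, -, hr⟩ := h
  refine ⟨r, fun i j => ?_⟩
  have : (B : Matrix (Fin 3) (Fin 3) F) = A * Matrix.scalar (Fin 3) r := by
    rw [hr, ← Matrix.SpecialLinearGroup.coe_mul]; simp
  rw [this]
  simp [mul_comm]

theorem closure_mk {x y : SL3 F} (h : Subgroup.closure {x, y} = ⊤) :
    Subgroup.closure {(x : Matrix.ProjectiveSpecialLinearGroup (Fin 3) F),
      (y : Matrix.ProjectiveSpecialLinearGroup (Fin 3) F)} = ⊤ := by
  have h1 := congrArg (Subgroup.map (QuotientGroup.mk' (Subgroup.center (SL3 F)))) h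
  rw [MonoidHom.map_closure, Set.image_pair,
    Subgroup.map_top_of_surjective _ (QuotientGroup.mk'_surjective _)] at h1
  exact h1

theorem asymA [Fintype F] (a : Fˣ) (ha3 : (a : F) ^ 3 ≠ 1)
    (φ : MulAut (Matrix.ProjectiveSpecialLinearGroup (Fin 3) F))
    (hx : φ (xA a : SL3 F) = ((xA a : SL3 F) : Matrix.ProjectiveSpecialLinearGroup (Fin 3) F)⁻¹)
    (hy : φ (yA : SL3 F) = ((yA : SL3 F) : Matrix.ProjectiveSpecialLinearGroup (Fin 3) F)⁻¹) :
    False := by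
  have h0 := commA a
  have h1 := h0.map (QuotientGroup.mk' (Subgroup.center (SL3 F)))
  rw [← xA_pow_card_sub a, ← xA_pow_card a] at h1
  simp only [map_mul, map_pow, map_inv] at h1
  have h2 := group_aux φ _ _ _ _ hx hy h1
  have hP : yA ^ 3 * E12 (-1 : F) * (yA ^ 3)⁻¹ = pA := by
    rw [mul_inv_eq_iff_eq_mul, yA_E12]
  rw [← xA_pow_card_sub a] at hP
  have h3 : ((pA * dA a : SL3 F) : Matrix.ProjectiveSpecialLinearGroup (Fin 3) F)
      = ((dA a * pA : SL3 F)) := by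
    rw [← hP, ← xA_pow_card a]
    exact h2
  obtain ⟨r, hr⟩ := mk_eq h3
  have h4 := hr 1 1
  have h5 := hr 0 2
  simp only [Matrix.SpecialLinearGroup.coe_mul] at h4 h5
  simp [pA, dA] at h4 h5
  apply ha3
  have h4' : r = 1 := by
    have := a.ne_zero
    field_simp at h4
    first | exact h4.symm | exact h4
  rw [h4'] at h5
  have := a.ne_zero
  field_simp at h5
  linear_combination h5

/-! ### The field with four elements -/

theorem exists_w [Fintype F] (h4 : Fintype.card F = 4) :
    (2 : F) = 0 ∧ ∃ w : F, w ^ 2 = w + 1 ∧ ∀ t : F, t = 0 ∨ t = 1 ∨ t = w ∨ t = w ^ 2 := by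
  classical
  have hc : ((4 : ℕ) : F) = 0 := by rw [← h4]; exact FiniteField.cast_card_eq_zero F
  have h2 : (2 : F) = 0 := by
    have : (2 : F) * 2 = 0 := by push_cast at hc; linear_combination hc
    rcases mul_eq_zero.1 this with h | h <;> exact h
  have hex : ∃ w : F, w ∉ ({0, 1} : Finset F) := by
    by_contra h
    push Not at h
    have h1 : Fintype.card F ≤ ({0, 1} : Finset F).card :=
      Finset.card_le_card (fun x _ => h x)
    have := Finset.card_le_two (a := (0 : F)) (b := 1)
    omega
  obtain ⟨w, hw⟩ := hex
  simp only [Finset.mem_insert, Finset.mem_singleton, not_or] at hw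
  have h3 : ∀ t : F, t ≠ 0 → t ^ 3 = 1 := by
    intro t ht
    have := FiniteField.pow_card_sub_one_eq_one t ht
    rwa [h4] at this
  have hw2 : w ^ 2 = w + 1 := by
    have : (w - 1) * (w ^ 2 + w + 1) = 0 := by linear_combination h3 w hw.1
    rcases mul_eq_zero.1 this with h | h
    · exact absurd (sub_eq_zero.1 h) hw.2
    · linear_combination h - (w + 1) * h2
  refine ⟨h2, w, hw2, fun t => ?_⟩
  by_cases ht : t = 0
  · exact Or.inl ht
  · right
    have h3w := h3 w hw.1
    have h : (t - 1) * ((t - w) * (t - w ^ 2)) = 0 := by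
      have e : w ^ 2 + w + 1 = 0 := by linear_combination hw2 + (w + 1) * h2
      linear_combination h3 t ht + (t - t ^ 2) * e + (t - 1) * h3w
    rcases mul_eq_zero.1 h with h | h
    · exact Or.inl (sub_eq_zero.1 h)
    · rcases mul_eq_zero.1 h with h | h
      · exact Or.inr (Or.inl (sub_eq_zero.1 h))
      · exact Or.inr (Or.inr (sub_eq_zero.1 h))

def xB (w : F) : SL3 F := ⟨!![1,w,w+1;0,1,1;0,0,1], by simp [Matrix.det_fin_three]⟩
def xB' (w : F) : SL3 F := ⟨!![1,w,1;0,1,1;0,0,1], by simp [Matrix.det_fin_three]⟩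

theorem xB_eq (w : F) : xB w = E12 w * E23 1 * E13 1 := by
  apply sl_ext; simp only [Matrix.SpecialLinearGroup.coe_mul]; simp [xB, E12, E23, E13, add_comm]
theorem xB'_eq (w : F) : xB' w = E23 1 * E12 w * E13 1 := by
  apply sl_ext; simp only [Matrix.SpecialLinearGroup.coe_mul]; simp [xB', E12, E23, E13]
theorem E13_add (s t : F) : E13 s * E13 t = E13 (s + t) := by
  apply sl_ext; simp only [Matrix.SpecialLinearGroup.coe_mul]; simp [E13, add_comm]

theorem xB_inv {w : F} (h2 : (2 : F) = 0) : (xB w)⁻¹ = xB' w := by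
  apply inv_eq_of_mul_eq_one_right
  apply sl_ext; simp only [Matrix.SpecialLinearGroup.coe_mul]
  ext i j
  fin_cases i <;> fin_cases j <;> simp [xB, xB', Matrix.mul_apply, Fin.sum_univ_three] <;> grind

theorem xB_sq {w : F} (h2 : (2 : F) = 0) : xB w * xB w = E13 w := by
  apply sl_ext; simp only [Matrix.SpecialLinearGroup.coe_mul]
  ext i j
  fin_cases i <;> fin_cases j <;> simp [xB, E13, Matrix.mul_apply, Fin.sum_univ_three] <;> grind

theorem xB'_sq {w : F} (h2 : (2 : F) = 0) : xB' w * xB' w = E13 w := by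
  apply sl_ext; simp only [Matrix.SpecialLinearGroup.coe_mul]
  ext i j
  fin_cases i <;> fin_cases j <;> simp [xB', E13, Matrix.mul_apply, Fin.sum_univ_three] <;> grind

theorem comm_21 (h2 : (2 : F) = 0) (t s : F) : E13 t * E21 s = E23 (t * s) * (E21 s * E13 t) := by
  have : -(t * s) = t * s := by linear_combination (-(t * s)) * h2
  rw [comm_13_21, this]

theorem xB_E23 {w : F} (h2 : (2 : F) = 0) (hw : w ^ 2 = w + 1) :
    xB w * E23 (w ^ 2) = E13 1 * (E23 (w ^ 2) * xB w) := by
  apply sl_ext; simp only [Matrix.SpecialLinearGroup.coe_mul]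
  ext i j
  fin_cases i <;> fin_cases j <;> simp [xB, E13, E23, Matrix.mul_apply, Fin.sum_univ_three] <;> grind

theorem xB'_E12 {w : F} (h2 : (2 : F) = 0) (hw : w ^ 2 = w + 1) :
    xB' w * E12 (w ^ 2) = E13 (w ^ 2) * (E12 (w ^ 2) * xB' w) := by
  apply sl_ext; simp only [Matrix.SpecialLinearGroup.coe_mul]
  ext i j
  fin_cases i <;> fin_cases j <;> simp [xB', E13, E12, Matrix.mul_apply, Fin.sum_univ_three] <;> grind

theorem genB {w : F} (h2 : (2 : F) = 0) (hw : w ^ 2 = w + 1)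
    (hall : ∀ t : F, t = 0 ∨ t = 1 ∨ t = w ∨ t = w ^ 2) :
    Subgroup.closure {xB w, cyc} = ⊤ := by
  set H := Subgroup.closure {xB w, cyc} with hH
  have hx : xB w ∈ H := Subgroup.subset_closure (by simp)
  have hc : cyc ∈ H := Subgroup.subset_closure (by simp)
  have a1 : E13 w ∈ H := by rw [← xB_sq h2]; exact H.mul_mem hx hx
  have a2 : E21 w ∈ H := conj_mem (cyc_E13 w) hc a1
  have a3 : E32 w ∈ H := conj_mem (cyc_E21 w) hc a2
  have a4 : E12 (w ^ 2) ∈ H := comm_mem (by rw [pow_two]; exact comm_13_32 w w) a1 a3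
  have a5 : E23 (w ^ 2) ∈ H := conj_mem (cyc_E12 _) hc a4
  have a6 : E13 1 ∈ H := comm_mem (xB_E23 h2 hw) hx a5
  have h13 : ∀ t : F, E13 t ∈ H := by
    intro t
    rcases hall t with rfl | rfl | rfl | rfl
    · have : E13 (0 : F) = E13 1 * E13 1 := by
        rw [E13_add]; congr 1; linear_combination -h2
      rw [this]; exact H.mul_mem a6 a6
    · exact a6
    · exact a1
    · rw [hw, ← E13_add]; exact H.mul_mem a1 a6
  exact top_of_cyc H hc fun t => conj_mem (cyc_E21 t) hc (conj_mem (cyc_E13 t) hc (h13 t))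

theorem phi_conj {G G' : Type*} [Group G] [Group G'] (π : G →* G') (φ : MulAut G') {c a b a' b' : G}
    (h : c * a = b * c) (h' : c * b' = a' * c) (hc : φ (π c) = (π c)⁻¹) (ha : φ (π a) = π a') :
    φ (π b) = π b' := by
  have e : b = c * a * c⁻¹ := (mul_inv_eq_iff_eq_mul.2 h).symm
  have e' : b' = c⁻¹ * (a' * c) := by rw [← h']; simp
  rw [e, e']
  simp only [map_mul, map_inv, hc, ha, inv_inv, mul_assoc]

theorem phi_comm {G G' : Type*} [Group G] [Group G'] (π : G →* G') (φ : MulAut G')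
    {a b k a' b' k' : G} (h : a * b = k * (b * a)) (h' : a' * b' = k' * (b' * a'))
    (ha : φ (π a) = π a') (hb : φ (π b) = π b') : φ (π k) = π k' := by
  have e : k = a * b * (b * a)⁻¹ := (mul_inv_eq_iff_eq_mul.2 h).symm
  have e' : k' = a' * b' * (b' * a')⁻¹ := (mul_inv_eq_iff_eq_mul.2 h').symm
  rw [e, e']
  simp only [map_mul, map_inv, ha, hb]

theorem asymB {w : F} (h2 : (2 : F) = 0) (hw : w ^ 2 = w + 1)
    (φ : MulAut (Matrix.ProjectiveSpecialLinearGroup (Fin 3) F))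
    (hx : φ (xB w : SL3 F) = ((xB w : SL3 F) : Matrix.ProjectiveSpecialLinearGroup (Fin 3) F)⁻¹)
    (hy : φ (cyc : SL3 F) = ((cyc : SL3 F) : Matrix.ProjectiveSpecialLinearGroup (Fin 3) F)⁻¹) :
    False := by
  have h3 : w * w ^ 2 = 1 := by linear_combination (w + 1) * hw + w * h2
  let π := QuotientGroup.mk' (Subgroup.center (SL3 F))
  have hc : φ (π cyc) = (π cyc)⁻¹ := hy
  have hx' : φ (π (xB w)) = π (xB' w) := by
    rw [← xB_inv h2, map_inv]; exact hx
  have f21 : ∀ t s, φ (π (E13 t)) = π (E13 s) → φ (π (E21 t)) = π (E32 s) := fun t s h =>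
    phi_conj π φ (cyc_E13 t) (cyc_E32 s) hc h
  have f32 : ∀ t s, φ (π (E13 t)) = π (E13 s) → φ (π (E32 t)) = π (E21 s) := fun t s h =>
    phi_conj π φ (cyc_E21 t) (cyc_E21 s) hc (f21 t s h)
  have f12 : ∀ t t' r r', φ (π (E13 t)) = π (E13 t') → φ (π (E13 r)) = π (E13 r') →
      φ (π (E12 (t * r))) = π (E23 (t' * r')) := fun t t' r r' h h' =>
    phi_comm π φ (comm_13_32 t r) (comm_21 h2 t' r') h (f32 r r' h')
  have f23 : ∀ t s, φ (π (E12 t)) = π (E23 s) → φ (π (E23 t)) = π (E12 s) := fun t s h =>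
    phi_conj π φ (cyc_E12 t) (cyc_E12 s) hc h
  have k1 : φ (π (E13 w)) = π (E13 w) := by
    conv_lhs => rw [← xB_sq h2]
    rw [← xB'_sq h2, map_mul, map_mul, hx', map_mul]
  have k2 : φ (π (E23 (w ^ 2))) = π (E12 (w ^ 2)) := by
    rw [pow_two]; exact f23 _ _ (f12 _ _ _ _ k1 k1)
  have k3 : φ (π (E13 1)) = π (E13 (w ^ 2)) :=
    phi_comm π φ (xB_E23 h2 hw) (xB'_E12 h2 hw) hx' k2
  have k4 : φ (π (E13 (w ^ 2))) = π (E13 1) := by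
    have e1 : E13 (w ^ 2) = E13 w * E13 1 := by rw [hw, E13_add]
    have e2 : E13 (1 : F) = E13 w * E13 (w ^ 2) := by
      rw [E13_add]; congr 1; linear_combination -hw - w * h2
    rw [e1, map_mul, map_mul, k1, k3, ← map_mul, ← e2]
  have k5 : φ (π (E12 w)) = π (E23 1) := by
    have := f12 _ _ _ _ k1 k3
    rwa [mul_one, h3] at this
  have k6 : φ (π (E23 1)) = π (E12 w) := by
    have := f23 _ _ (f12 _ _ _ _ k1 k4)
    rwa [mul_one, h3] at this
  have k7 : φ (π (xB w)) = π (E23 1 * E12 w * E13 (w ^ 2)) := by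
    rw [xB_eq, map_mul, map_mul, map_mul, map_mul, k3, k5, k6, map_mul, map_mul]
  rw [hx', xB'_eq, map_mul π (E23 1 * E12 w), map_mul π (E23 1 * E12 w), mul_right_inj] at k7
  obtain ⟨r, hr⟩ := mk_eq k7
  have r1 := hr 0 0
  have r2 := hr 0 2
  simp [E13] at r1 r2
  rw [← r1] at r2
  have hw0 : w = 0 := by linear_combination r2 - hw
  rw [hw0] at h3
  simp at h3

theorem exists_pair [Fintype F] (hq : 2 < Fintype.card F) :
    ∃ x y : Matrix.ProjectiveSpecialLinearGroup (Fin 3) F,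
        Subgroup.closure {x, y} = ⊤ ∧
          ¬∃ φ : MulAut (Matrix.ProjectiveSpecialLinearGroup (Fin 3) F),
            φ x = x⁻¹ ∧ φ y = y⁻¹ := by
  by_cases h4 : Fintype.card F = 4
  · obtain ⟨h2, w, hw, hall⟩ := exists_w h4
    refine ⟨_, _, closure_mk (genB h2 hw hall), ?_⟩
    rintro ⟨φ, h, h'⟩
    exact asymB h2 hw φ h h'
  · obtain ⟨a, ha⟩ := IsCyclic.exists_generator (α := Fˣ)
    have ha3 : (a : F) ^ 3 ≠ 1 := by
      intro h
      have hord : orderOf a = Fintype.card F - 1 := by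
        rw [orderOf_eq_card_of_forall_mem_zpowers ha, Nat.card_units, Nat.card_eq_fintype_card]
      have h1 : a ^ 3 = 1 := by ext; simpa using h
      have hd := orderOf_dvd_of_pow_eq_one h1
      rcases (Nat.dvd_prime Nat.prime_three).1 hd with h | h <;> omega
    refine ⟨_, _, closure_mk (genA hq h4 a ha ha3), ?_⟩
    rintro ⟨φ, h, h'⟩
    exact asymA a ha3 φ h h'

end PSL3

/-- For every prime power `q > 2`, the group `PSL(3, q)` is not strongly symmetric:
there is a generating pair `x, y` of `PSL(3, q)` such that no automorphism of
`PSL(3, q)` inverts both `x` and `y`. -/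
theorem psl_three_not_strongly_symmetric
    (q : ℕ) (hq : IsPrimePow q) (hq2 : 2 < q)
    (F : Type*) [Field F] [Fintype F] (hF : Fintype.card F = q) :
    ¬ StronglySymmetric (Matrix.ProjectiveSpecialLinearGroup (Fin 3) F) ∧
      ∃ x y : Matrix.ProjectiveSpecialLinearGroup (Fin 3) F,
        Subgroup.closure {x, y} = ⊤ ∧
          ¬∃ φ : MulAut (Matrix.ProjectiveSpecialLinearGroup (Fin 3) F),
            φ x = x⁻¹ ∧ φ y = y⁻¹ := by
  have h := PSL3.exists_pair (F := F) (by omega)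
  refine ⟨?_, h⟩
  rintro ⟨-, hs⟩
  obtain ⟨x, y, hxy, hn⟩ := h
  exact hn (hs x y hxy)
end

section
/- For every prime power q with q > 2, the group PSU(3,q) is not strongly symmetric: there exist x, y generating PSU(3,q) such that no automorphism φ of PSU(3,q) satisfies φ(x) = x⁻¹ and φ(y) = y⁻¹. Here PSU(3,q) is the quotient by its center of the special unitary group SU(3,q) = { g ∈ SL(3, F_{q²}) : (g^φ)ᵀ · g = 1 }, where g^φ denotes the matrix obtained from g by applying the field automorphism x ↦ x^q of F_{q²} to each entry. -/
open scoped Matrix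

/-- The special unitary group `SU(3, q)` determined by a ring endomorphism `φ` of a
field `F` (to be thought of as the Frobenius `x ↦ x ^ q` of `F = F_{q²}`): the subgroup
of `SL(3, F)` consisting of the matrices `g` with `(g^φ)ᵀ * g = 1`, where `g^φ` is the
entrywise application of `φ`. -/
def SU3 (F : Type*) [Field F] (φ : F →+* F) :
    Subgroup (Matrix.SpecialLinearGroup (Fin 3) F) where
  carrier := {g | ((g : Matrix (Fin 3) (Fin 3) F).map φ)ᵀ * (g : Matrix (Fin 3) (Fin 3) F) = 1}
  one_mem' := by
    simp [Matrix.SpecialLinearGroup.coe_one, Matrix.map_one φ (map_zero φ) (map_one φ)]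
  mul_mem' := by
    intro a b ha hb
    simp only [Set.mem_setOf_eq, Matrix.SpecialLinearGroup.coe_mul] at *
    rw [Matrix.map_mul, Matrix.transpose_mul, mul_assoc, ← mul_assoc ((a : Matrix (Fin 3) (Fin 3) F).map φ)ᵀ,
      ha, one_mul, hb]
  inv_mem' := by
    intro g hg
    simp only [Set.mem_setOf_eq] at *
    have h1 : (g : Matrix (Fin 3) (Fin 3) F) * ((g⁻¹ : Matrix.SpecialLinearGroup (Fin 3) F) : Matrix (Fin 3) (Fin 3) F) = 1 := by
      rw [← Matrix.SpecialLinearGroup.coe_mul, mul_inv_cancel]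
      rfl
    have h2 : ((g : Matrix (Fin 3) (Fin 3) F).map φ) *
        (((g⁻¹ : Matrix.SpecialLinearGroup (Fin 3) F) : Matrix (Fin 3) (Fin 3) F).map φ) = 1 := by
      rw [← Matrix.map_mul, h1, Matrix.map_one φ (map_zero φ) (map_one φ)]
    have h3 : (((g⁻¹ : Matrix.SpecialLinearGroup (Fin 3) F) : Matrix (Fin 3) (Fin 3) F).map φ)ᵀ *
        ((g : Matrix (Fin 3) (Fin 3) F).map φ)ᵀ = 1 := by
      rw [← Matrix.transpose_mul, h2, Matrix.transpose_one]
    have h4 : (((g⁻¹ : Matrix.SpecialLinearGroup (Fin 3) F) : Matrix (Fin 3) (Fin 3) F).map φ)ᵀ =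
        (g : Matrix (Fin 3) (Fin 3) F) := by
      calc (((g⁻¹ : Matrix.SpecialLinearGroup (Fin 3) F) : Matrix (Fin 3) (Fin 3) F).map φ)ᵀ
          = (((g⁻¹ : Matrix.SpecialLinearGroup (Fin 3) F) : Matrix (Fin 3) (Fin 3) F).map φ)ᵀ *
            (((g : Matrix (Fin 3) (Fin 3) F).map φ)ᵀ * (g : Matrix (Fin 3) (Fin 3) F)) := by
            rw [hg, mul_one]
        _ = ((((g⁻¹ : Matrix.SpecialLinearGroup (Fin 3) F) : Matrix (Fin 3) (Fin 3) F).map φ)ᵀ *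
            ((g : Matrix (Fin 3) (Fin 3) F).map φ)ᵀ) * (g : Matrix (Fin 3) (Fin 3) F) := by
            rw [mul_assoc]
        _ = (g : Matrix (Fin 3) (Fin 3) F) := by rw [h3, one_mul]
    rw [h4, h1]


def uM {F : Type*} [Field F] (φ : F →+* F) (a b : F) : Matrix (Fin 3) (Fin 3) F :=
  !![1, a, b; 0, 1, -φ a; 0, 0, 1]

def hM {F : Type*} [Field F] (φ : F →+* F) (t : F) : Matrix (Fin 3) (Fin 3) F :=
  !![t, 0, 0; 0, φ t / t, 0; 0, 0, (φ t)⁻¹]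

def wM (F : Type*) [Field F] : Matrix (Fin 3) (Fin 3) F :=
  !![0, 0, 1; 0, -1, 0; 1, 0, 0]

def jM (F : Type*) [Field F] : Matrix (Fin 3) (Fin 3) F :=
  !![0, 0, 1; 0, 1, 0; 1, 0, 0]

def starM {F : Type*} [Field F] (φ : F →+* F) (m : Matrix (Fin 3) (Fin 3) F) :
    Matrix (Fin 3) (Fin 3) F := (m.map φ)ᵀ

theorem m3_ext {F : Type*} {a b c d e f g h i a' b' c' d' e' f' g' h' i' : F}
    (h1 : a = a') (h2 : b = b') (h3 : c = c') (h4 : d = d') (h5 : e = e') (h6 : f = f')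
    (h7 : g = g') (h8 : h = h') (h9 : i = i') :
    !![a, b, c; d, e, f; g, h, i] = !![a', b', c'; d', e', f'; g', h', i'] := by
  subst h1 h2 h3 h4 h5 h6 h7 h8 h9; rfl

section
variable {F : Type*} [Field F] (φ : F →+* F)

theorem starM_mul (m n : Matrix (Fin 3) (Fin 3) F) : starM φ (m * n) = starM φ n * starM φ m := by
  simp [starM, Matrix.map_mul, Matrix.transpose_mul]

theorem starM_of (a b c d e f g h i : F) :
    starM φ !![a, b, c; d, e, f; g, h, i] =
      !![φ a, φ d, φ g; φ b, φ e, φ h; φ c, φ f, φ i] := by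
  ext i j; fin_cases i <;> fin_cases j <;> rfl

theorem uM_mul (a b a' b' : F) :
    uM φ a b * uM φ a' b' = uM φ (a + a') (b + b' - a * φ a') := by
  simp only [uM, Matrix.mul_fin_three, map_add]
  apply m3_ext <;> ring

theorem uM_zero : uM φ 0 0 = 1 := by
  simp [uM, Matrix.one_fin_three]

theorem hM_mul (t s : F) : hM φ t * hM φ s = hM φ (t * s) := by
  simp only [hM, Matrix.mul_fin_three, map_mul]
  apply m3_ext <;> simp [mul_comm, div_mul_div_comm]

theorem hM_one : hM φ 1 = 1 := by
  simp [hM, Matrix.one_fin_three]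

theorem hM_uM {t : F} (ht : t ≠ 0) (hφφ : ∀ x, φ (φ x) = x) (a b : F) :
    hM φ t * uM φ a b = uM φ (t ^ 2 / φ t * a) (t * φ t * b) * hM φ t := by
  have : φ t ≠ 0 := by simpa using ht
  simp only [hM, uM, Matrix.mul_fin_three, map_mul, map_div₀, map_pow, hφφ]
  apply m3_ext <;> first | ring1 | (field_simp; done) | (field_simp; ring1)

theorem hM_iso {t : F} (ht : t ≠ 0) (hφφ : ∀ x, φ (φ x) = x) :
    starM φ (hM φ t) * jM F * hM φ t = jM F := by
  have : φ t ≠ 0 := by simpa using ht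
  simp only [hM, jM, starM_of, Matrix.mul_fin_three, map_zero, map_inv₀, map_div₀, hφφ]
  apply m3_ext <;> first | ring1 | (field_simp; done) | (field_simp; ring1)

theorem hM_det {t : F} (ht : t ≠ 0) : (hM φ t).det = 1 := by
  have : φ t ≠ 0 := by simpa using ht
  simp [hM, Matrix.det_fin_three]
  field_simp

theorem uM_iso {a b : F} (hφφ : ∀ x, φ (φ x) = x) (h : b + φ b + a * φ a = 0) :
    starM φ (uM φ a b) * jM F * uM φ a b = jM F := by
  simp only [uM, jM, starM_of, Matrix.mul_fin_three, map_zero, map_one, map_neg, hφφ]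
  apply m3_ext <;> first | ring1 | linear_combination h

theorem uM_det (a b : F) : (uM φ a b).det = 1 := by
  simp [uM, Matrix.det_fin_three]

theorem wM_iso : starM φ (wM F) * jM F * wM F = jM F := by
  simp only [wM, jM, starM_of, Matrix.mul_fin_three, map_zero, map_one, map_neg]
  apply m3_ext <;> ring

theorem wM_det : (wM F).det = 1 := by
  simp [wM, Matrix.det_fin_three]

theorem wM_hM_sq {t : F} (ht : t ≠ 0) (hφφ : ∀ x, φ (φ x) = x) :
    wM F * hM φ t * wM F * hM φ t = hM φ (t / φ t) := by
  have : φ t ≠ 0 := by simpa using ht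
  simp only [hM, wM, Matrix.mul_fin_three, map_div₀, hφφ]
  apply m3_ext <;> first | ring1 | (field_simp; done) | (field_simp; ring1)

end

/-- A faithful matrix model of a group as the special unitary group of the antidiagonal form. -/
structure Model (F : Type*) [Field F] (φ : F →+* F) (G : Type*) [Group G] where
  ρ : G →* Matrix (Fin 3) (Fin 3) F
  inj : Function.Injective ρ
  iso : ∀ g, starM φ (ρ g) * jM F * ρ g = jM F
  det : ∀ g, (ρ g).det = 1
  surj : ∀ m, starM φ m * jM F * m = jM F → m.det = 1 → ∃ g, ρ g = m

/-- The field data needed: `t` is a primitive root. -/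
structure FieldData {F : Type*} [Field F] (φ : F →+* F) (t : F) : Prop where
  invol : ∀ x, φ (φ x) = x
  ne_zero : t ≠ 0
  gen : ∀ s : F, s ≠ 0 → ∃ k : ℕ, t ^ k = s
  top : ∀ S : Subring F, t ^ 2 / φ t ∈ S → S = ⊤
  lam : ∃ l : F, l + φ l = 1
  t_ne : φ t ≠ t
  cube : (t / φ t) ^ 3 ≠ 1
  aut : ∀ σ : F →+* F, σ (t ^ 2 / φ t) ≠ (t ^ 2 / φ t)⁻¹

/-- `g` is upper unitriangular with parameter `a`. -/
def IsU {F : Type*} [Field F] {φ : F →+* F} {G : Type*} [Group G] (M : Model F φ G)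
    (g : G) (a : F) : Prop := ∃ b, M.ρ g = uM φ a b

section
variable {F : Type*} [Field F] {φ : F →+* F} {G : Type*} [Group G] (M : Model F φ G) {t : F}

theorem iso_entry (g : G) (i j : Fin 3) :
    φ (M.ρ g 0 i) * M.ρ g 2 j + φ (M.ρ g 1 i) * M.ρ g 1 j + φ (M.ρ g 2 i) * M.ρ g 0 j
      = jM F i j := by
  rw [← M.iso g]
  simp [Matrix.mul_apply, Fin.sum_univ_three, starM, jM]
  ring

theorem uM_cond {g : G} {a b : F} (h : M.ρ g = uM φ a b) (hφφ : ∀ x, φ (φ x) = x) :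
    b + φ b + a * φ a = 0 := by
  have := iso_entry M g 2 2
  simp [h, uM, jM, hφφ] at this
  linear_combination this

theorem exists_u (D : FieldData φ t) {a b : F} (h : b + φ b + a * φ a = 0) :
    ∃ g, M.ρ g = uM φ a b :=
  M.surj _ (uM_iso φ D.invol h) (uM_det φ a b)

theorem exists_h (D : FieldData φ t) {s : F} (hs : s ≠ 0) : ∃ g, M.ρ g = hM φ s :=
  M.surj _ (hM_iso φ hs D.invol) (hM_det φ hs)

theorem exists_isU (D : FieldData φ t) (a : F) : ∃ g, IsU M g a := by
  obtain ⟨l, hl⟩ := D.lam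
  obtain ⟨g, hg⟩ := exists_u M D (a := a) (b := -(l * (a * φ a))) (by
    simp only [map_neg, map_mul, D.invol]
    linear_combination (-a * φ a) * hl)
  exact ⟨g, _, hg⟩

theorem isU_one : IsU M 1 0 := ⟨0, by rw [map_one, uM_zero]⟩

theorem IsU.mul {M : Model F φ G} {g g' : G} {a a' : F} (h : IsU M g a) (h' : IsU M g' a') :
    IsU M (g * g') (a + a') := by
  obtain ⟨b, hb⟩ := h
  obtain ⟨b', hb'⟩ := h'
  exact ⟨_, by rw [map_mul, hb, hb', uM_mul]⟩

theorem rho_inv (D : FieldData φ t) {g : G} {a b : F} (h : M.ρ g = uM φ a b) :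
    M.ρ g⁻¹ = uM φ (-a) (φ b) := by
  have hc := uM_cond M h D.invol
  obtain ⟨g', hg'⟩ := exists_u M D (a := -a) (b := φ b) (by
    simp only [map_neg, D.invol]
    linear_combination hc)
  have : g * g' = 1 := by
    apply M.inj
    rw [map_mul, h, hg', uM_mul, map_one, ← uM_zero φ]
    congr 1
    · ring
    · rw [map_neg]; linear_combination hc
  rw [inv_eq_of_mul_eq_one_right this, hg']

theorem IsU.inv {M : Model F φ G} (D : FieldData φ t) {g : G} {a : F} (h : IsU M g a) :
    IsU M g⁻¹ (-a) := by
  obtain ⟨b, hb⟩ := h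
  exact ⟨_, rho_inv M D hb⟩

theorem IsU.conj {M : Model F φ G} (D : FieldData φ t) {g x : G} {a s : F} (hs : s ≠ 0)
    (hx : M.ρ x = hM φ s) (h : IsU M g a) : IsU M (x * g * x⁻¹) (s ^ 2 / φ s * a) := by
  obtain ⟨b, hb⟩ := h
  refine ⟨s * φ s * b, ?_⟩
  have h1 : M.ρ x * M.ρ g = uM φ (s ^ 2 / φ s * a) (s * φ s * b) * M.ρ x := by
    rw [hx, hb, hM_uM φ hs D.invol]
  have h2 : M.ρ x * M.ρ x⁻¹ = 1 := by rw [← map_mul, mul_inv_cancel, map_one]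
  rw [map_mul, map_mul, h1, mul_assoc, h2, mul_one]

theorem IsU.comm {M : Model F φ G} (D : FieldData φ t) {g g' : G} {a a' : F}
    (h : IsU M g a) (h' : IsU M g' a') :
    M.ρ (g * g' * g⁻¹ * g'⁻¹) = uM φ 0 (a' * φ a - a * φ a') := by
  obtain ⟨b, hb⟩ := h
  obtain ⟨b', hb'⟩ := h'
  obtain ⟨c, hc⟩ := exists_u M D (a := 0) (b := a' * φ a - a * φ a') (by
    simp only [map_sub, map_mul, D.invol]; ring)
  have : g * g' = c * (g' * g) := by
    apply M.inj
    simp only [map_mul, hb, hb', hc, uM_mul]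
    congr 1 <;> ring
  rw [this, ← hc]
  congr 1
  group

theorem rho_h_inv (D : FieldData φ t) {x : G} {s : F} (hs : s ≠ 0) (hx : M.ρ x = hM φ s) :
    M.ρ x⁻¹ = hM φ s⁻¹ := by
  obtain ⟨g, hg⟩ := exists_h M D (inv_ne_zero hs)
  have : x * g = 1 := by
    apply M.inj
    rw [map_mul, hx, hg, hM_mul, mul_inv_cancel₀ hs, hM_one, map_one]
  rw [inv_eq_of_mul_eq_one_right this, hg]

theorem rho_h_pow {x : G} {s : F} (hx : M.ρ x = hM φ s) (k : ℕ) :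
    M.ρ (x ^ k) = hM φ (s ^ k) := by
  induction k with
  | zero => simp [hM_one]
  | succ k ih => rw [pow_succ, map_mul, ih, hx, hM_mul, pow_succ]

theorem h_mem (D : FieldData φ t) {x : G} (hx : M.ρ x = hM φ t) {H : Subgroup G} (hxH : x ∈ H)
    {h : G} {s : F} (hs : s ≠ 0) (hh : M.ρ h = hM φ s) : h ∈ H := by
  obtain ⟨k, rfl⟩ := D.gen s hs
  have : h = x ^ k := M.inj (by rw [hh, rho_h_pow M hx])
  rw [this]
  exact pow_mem hxH k

/-- The Borel subgroup condition. -/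
def Upper (g : G) : Prop := M.ρ g 1 0 = 0 ∧ M.ρ g 2 0 = 0

theorem upper_decomp (D : FieldData φ t) {g : G} (hg : Upper M g) :
    ∃ s h u a, s ≠ 0 ∧ M.ρ h = hM φ s ∧ IsU M u a ∧ g = h * u := by
  obtain ⟨h10, h20⟩ := hg
  have e02 := iso_entry M g 0 2
  have e01 := iso_entry M g 0 1
  have e12 := iso_entry M g 1 2
  have e22 := iso_entry M g 2 2
  have ed := M.det g
  rw [Matrix.det_fin_three] at ed
  have heta := Matrix.eta_fin_three (M.ρ g)
  simp [h10, h20, jM] at e02 e01 e12 e22 ed heta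
  generalize M.ρ g 0 0 = s at *
  generalize M.ρ g 0 1 = p at *
  generalize M.ρ g 0 2 = r at *
  generalize M.ρ g 1 1 = c at *
  generalize M.ρ g 1 2 = d at *
  generalize M.ρ g 2 1 = e at *
  generalize M.ρ g 2 2 = f at *
  have hs : s ≠ 0 := by rintro rfl; simp at e02
  have hφs : φ s ≠ 0 := by simpa using hs
  have he : e = 0 := by simpa [hs] using e01
  subst he
  have hf : f = (φ s)⁻¹ := by field_simp; linear_combination e02
  subst hf
  have hc : c = φ s / s := by
    field_simp at ed ⊢
    linear_combination ed
  subst hc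
  have hd : d = - φ p / s := by
    simp only [map_div₀, D.invol] at e12
    field_simp at e12 ⊢
    simp at e12
    linear_combination e12
  subst hd
  simp only [map_div₀, map_neg, map_inv₀, D.invol] at e22
  obtain ⟨h, hh⟩ := exists_h M D hs
  obtain ⟨u, hu⟩ := exists_u M D (a := p / s) (b := r / s) (by
    simp only [map_div₀]
    field_simp at e22 ⊢
    linear_combination e22)
  refine ⟨s, h, u, p / s, hs, hh, ⟨_, hu⟩, M.inj ?_⟩
  rw [heta, map_mul, hh, hu, hM, uM, Matrix.mul_fin_three]
  simp only [map_div₀]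
  apply m3_ext <;> first | ring1 | (field_simp; done) | (field_simp; ring1)

theorem bruhat (D : FieldData φ t) {w : G} (hw : M.ρ w = wM F) (g : G) :
    Upper M g ∨ ∃ u b a, IsU M u a ∧ Upper M b ∧ g = u * w * b := by
  have e00 := iso_entry M g 0 0
  simp [jM] at e00
  by_cases h : M.ρ g 2 0 = 0
  · left
    refine ⟨?_, h⟩
    simpa [h] using e00
  right
  have h' : φ (M.ρ g 2 0) ≠ 0 := by simpa using h
  obtain ⟨u, hu⟩ := exists_u M D (a := - φ (M.ρ g 1 0) / φ (M.ρ g 2 0))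
    (b := M.ρ g 0 0 / M.ρ g 2 0) (by
      simp only [map_div₀, map_neg, D.invol]
      field_simp
      linear_combination e00)
  refine ⟨u, w⁻¹ * u⁻¹ * g, _, ⟨_, hu⟩, ?_, by group⟩
  have hw' : w⁻¹ = w := by
    apply inv_eq_of_mul_eq_one_right
    apply M.inj
    simp [hw, wM, Matrix.one_fin_three]
  have hm : M.ρ (w⁻¹ * u⁻¹ * g) = wM F * uM φ (-(- φ (M.ρ g 1 0) / φ (M.ρ g 2 0)))
      (φ (M.ρ g 0 0 / M.ρ g 2 0)) * M.ρ g := by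
    rw [hw', map_mul, map_mul, hw, rho_inv M D hu]
  constructor
  · rw [hm]
    simp [Matrix.mul_apply, Fin.sum_univ_three, wM, uM, D.invol]
    field_simp
    ring
  · rw [hm]
    simp [Matrix.mul_apply, Fin.sum_univ_three, wM, uM, D.invol]
    field_simp
    linear_combination e00

theorem upper_mem (D : FieldData φ t) {x z : G} (hx : M.ρ x = hM φ t) {H : Subgroup G}
    (hxH : x ∈ H) (hzH : z ∈ H) {a₀ : F} (ha₀ : a₀ ≠ 0) (hz : IsU M z a₀) {g : G}
    (hg : Upper M g) : g ∈ H := by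
  let S : AddSubgroup F :=
    { carrier := {a | ∃ g ∈ H, IsU M g a}
      zero_mem' := ⟨1, one_mem H, isU_one M⟩
      add_mem' := by
        rintro a b ⟨g, hg, ha⟩ ⟨g', hg', ha'⟩
        exact ⟨_, mul_mem hg hg', ha.mul ha'⟩
      neg_mem' := by
        rintro a ⟨g, hg, ha⟩
        exact ⟨_, inv_mem hg, ha.inv D⟩ }
  let R : Subring F :=
    { carrier := {r | ∀ a ∈ S, r * a ∈ S}
      zero_mem' := by intro a _; rw [zero_mul]; exact S.zero_mem
      one_mem' := by intro a h; rwa [one_mul]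
      add_mem' := by intro r s hr hs a ha; rw [add_mul]; exact S.add_mem (hr a ha) (hs a ha)
      mul_mem' := by intro r s hr hs a ha; rw [mul_assoc]; exact hr _ (hs a ha)
      neg_mem' := by intro r hr a ha; rw [neg_mul]; exact S.neg_mem (hr a ha) }
  have hR : R = ⊤ := by
    apply D.top
    rintro a ⟨g, hg, ha⟩
    exact ⟨_, mul_mem (mul_mem hxH hg) (inv_mem hxH), ha.conj D D.ne_zero hx⟩
  have hS : ∀ a, ∃ g ∈ H, IsU M g a := by
    intro a
    have h1 : a / a₀ ∈ R := by rw [hR]; trivial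
    have h2 := h1 a₀ ⟨z, hzH, hz⟩
    rw [div_mul_cancel₀ _ ha₀] at h2
    exact h2
  have hZ : ∀ c : G, ∀ b : F, M.ρ c = uM φ 0 b → c ∈ H := by
    intro c b hc
    have hb := uM_cond M hc D.invol
    simp at hb
    obtain ⟨l, hl⟩ := D.lam
    obtain ⟨g, hg, ha⟩ := hS 1
    obtain ⟨g', hg', ha'⟩ := hS (b * l)
    have := ha.comm D ha'
    have h2 : c = g * g' * g⁻¹ * g'⁻¹ := by
      apply M.inj
      rw [hc, this]
      congr 1
      simp only [map_one, map_mul]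
      linear_combination (-b) * hl + (φ l) * hb
    rw [h2]
    exact mul_mem (mul_mem (mul_mem hg hg') (inv_mem hg)) (inv_mem hg')
  have hU : ∀ u a, IsU M u a → u ∈ H := by
    intro u a hu
    obtain ⟨g, hg, ha⟩ := hS a
    obtain ⟨b, hb⟩ := hu.mul (ha.inv D)
    rw [add_neg_cancel] at hb
    have := mul_mem (hZ _ _ hb) hg
    rwa [inv_mul_cancel_right] at this
  obtain ⟨s, h, u, a, hs, hh, hu, rfl⟩ := upper_decomp M D hg
  exact mul_mem (h_mem M D hx hxH hs hh) (hU _ _ hu)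

end

section
variable {F : Type*} [Field F] {φ : F →+* F} {G : Type*} [Group G] (M : Model F φ G) {t : F}

/-- The Borel subgroup. -/
def borelSub : Subgroup G where
  carrier := {g | Upper M g}
  one_mem' := by simp [Upper]
  mul_mem' := by
    rintro a b ⟨ha1, ha2⟩ ⟨hb1, hb2⟩
    simp [Upper, Matrix.mul_apply, Fin.sum_univ_three, ha1, ha2, hb1, hb2]
  inv_mem' := by
    rintro g ⟨h1, h2⟩
    have h : M.ρ g⁻¹ * M.ρ g = 1 := by rw [← map_mul, inv_mul_cancel, map_one]
    have e0 := congrFun (congrFun h 0) 0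
    have e1 := congrFun (congrFun h 1) 0
    have e2 := congrFun (congrFun h 2) 0
    simp [Matrix.mul_apply, Fin.sum_univ_three, h1, h2] at e0 e1 e2
    have h3 : M.ρ g 0 0 ≠ 0 := by intro h; simp [h] at e0
    simp only [h3, or_false] at e1 e2
    exact ⟨e1, e2⟩

theorem mem_borelSub {g : G} : g ∈ borelSub M ↔ Upper M g := Iff.rfl

theorem IsU.upper {M : Model F φ G} {g : G} {a : F} (h : IsU M g a) : g ∈ borelSub M := by
  obtain ⟨b, hb⟩ := h
  simp [mem_borelSub, Upper, hb, uM]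

theorem h_upper {g : G} {s : F} (h : M.ρ g = hM φ s) : g ∈ borelSub M := by
  simp [mem_borelSub, Upper, h, hM]

theorem comm_isU (D : FieldData φ t) {x b : G} {s : F} (hs : s ≠ 0) (hx : M.ρ x = hM φ s)
    (hb : b ∈ borelSub M) : ∃ a, IsU M (x * b * x⁻¹ * b⁻¹) a := by
  obtain ⟨r, h, u, a, hr, hh, hu, rfl⟩ := upper_decomp M D hb
  have hc : x * h = h * x := M.inj (by rw [map_mul, map_mul, hx, hh, hM_mul, hM_mul, mul_comm])
  have h1 := ((hu.conj D hs hx).mul (hu.inv D)).conj D hr hh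
  have h2 : x * (h * u) * x⁻¹ * (h * u)⁻¹ = h * (x * u * x⁻¹ * u⁻¹) * h⁻¹ := by
    rw [← mul_assoc x, hc]; group
  rw [h2]
  exact ⟨_, h1⟩

theorem central_eq (D : FieldData φ t) {w : G} (hw : M.ρ w = wM F) {x g : G} {s v : F}
    (hs : s ≠ 0) (hs1 : s ^ 2 / φ s ≠ 1) (hx : M.ρ x = hM φ s) (hg : IsU M g v)
    (h : ∀ b ∈ borelSub M, g * (x * b * x⁻¹ * b⁻¹) * g⁻¹ * (x * b * x⁻¹ * b⁻¹)⁻¹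
      ∈ Subgroup.center G) : v = 0 := by
  have key : ∀ a' : F, a' * φ v - v * φ a' = 0 := by
    intro a'
    obtain ⟨b, hb⟩ := exists_isU M D (a' / (s ^ 2 / φ s - 1))
    have h1 := (hb.conj D hs hx).mul (hb.inv D)
    have h2 := hg.comm D h1
    have h3 := Subgroup.mem_center_iff.1 (h b hb.upper) w
    have h4 := congrArg M.ρ h3
    rw [map_mul M.ρ w, map_mul M.ρ _ w, h2, hw] at h4
    have h5 := congrFun (congrFun h4 0) 0
    have h6 : s ^ 2 / φ s * (a' / (s ^ 2 / φ s - 1)) + -(a' / (s ^ 2 / φ s - 1)) = a' := by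
      have : s ^ 2 / φ s - 1 ≠ 0 := sub_ne_zero.2 hs1
      generalize s ^ 2 / φ s = T at *
      field_simp
      ring
    rw [h6] at h5
    simp [Matrix.mul_apply, Fin.sum_univ_three, wM, uM] at h5
    linear_combination -h5
  have k1 := key 1
  have k2 := key t
  simp at k1
  have : v * (t - φ t) = 0 := by linear_combination k2 - t * k1
  rcases mul_eq_zero.1 this with h | h
  · exact h
  · exact absurd (sub_eq_zero.1 h).symm D.t_ne

theorem tau_ne_one (D : FieldData φ t) : t ^ 2 / φ t ≠ 1 := by
  intro h
  apply D.aut (RingHom.id F)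
  simp [h]

theorem tau_inv : (t⁻¹) ^ 2 / φ t⁻¹ = (t ^ 2 / φ t)⁻¹ := by
  simp [div_eq_mul_inv, mul_comm]

/-- An automorphism of the quotient by the center stabilizing the image of the Borel subgroup
cannot invert the torus generator. -/
theorem no_aut (D : FieldData φ t) {w x : G} (hw : M.ρ w = wM F) (hx : M.ρ x = hM φ t)
    (ψ : MulAut (G ⧸ Subgroup.center G))
    (hψx : ψ (QuotientGroup.mk' _ x) = (QuotientGroup.mk' _ x)⁻¹)
    (h1 : ∀ b ∈ borelSub M, ∃ b' ∈ borelSub M, ψ (QuotientGroup.mk' _ b) = QuotientGroup.mk' _ b')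
    (h2 : ∀ b' ∈ borelSub M, ∃ b ∈ borelSub M, ψ (QuotientGroup.mk' _ b) = QuotientGroup.mk' _ b') :
    False := by
  set π := QuotientGroup.mk' (Subgroup.center G) with hπ
  have hπ1 : ∀ g : G, π g = 1 ↔ g ∈ Subgroup.center G := fun g => QuotientGroup.eq_one_iff g
  have ht := D.ne_zero
  have hτ1 := tau_ne_one D
  have hx' := rho_h_inv M D ht hx
  have ht' : t⁻¹ ≠ 0 := inv_ne_zero ht
  have hτ1' : (t⁻¹) ^ 2 / φ t⁻¹ ≠ 1 := by rw [tau_inv]; exact inv_ne_one.2 hτ1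
  have hcomm : ∀ b b', ψ (π b) = π b' →
      ψ (π (x * b * x⁻¹ * b⁻¹)) = π (x⁻¹ * b' * x⁻¹⁻¹ * b'⁻¹) := by
    intro b b' h
    simp only [map_mul, map_inv, h, hψx]
  have hcomm2 : ∀ g g' c c', ψ (π g) = π g' → ψ (π c) = π c' →
      ψ (π (g * c * g⁻¹ * c⁻¹)) = π (g' * c' * g'⁻¹ * c'⁻¹) := by
    intro g g' c c' h h'
    simp only [map_mul, map_inv, h, h']
  have htriv : ∀ g c a, IsU M g 0 → IsU M c a → g * c * g⁻¹ * c⁻¹ = 1 := by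
    intro g c a hg hc
    apply M.inj
    rw [hg.comm D hc, map_one, ← uM_zero φ]
    simp
  let R : AddSubgroup (F × F) :=
    { carrier := {p | ∃ g g', IsU M g p.1 ∧ IsU M g' p.2 ∧ ψ (π g) = π g'}
      zero_mem' := ⟨1, 1, isU_one M, isU_one M, by simp⟩
      add_mem' := by
        rintro p r ⟨g, g', hg, hg', h⟩ ⟨k, k', hk, hk', h'⟩
        exact ⟨_, _, hg.mul hk, hg'.mul hk', by simp only [map_mul, h, h']⟩
      neg_mem' := by
        rintro p ⟨g, g', hg, hg', h⟩
        exact ⟨_, _, hg.inv D, hg'.inv D, by simp only [map_inv, h]⟩ }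
  have hfun : ∀ v', ((0 : F), v') ∈ R → v' = 0 := by
    rintro v' ⟨g, g', hg, hg', h⟩
    refine central_eq M D hw ht' hτ1' hx' hg' ?_
    intro b' hb'
    obtain ⟨b, hb, hbb⟩ := h2 b' hb'
    obtain ⟨a, ha⟩ := comm_isU M D ht hx hb
    rw [← hπ1, ← hcomm2 g g' _ _ h (hcomm b b' hbb), htriv _ _ _ hg ha, map_one, map_one]
  have hfun2 : ∀ v, (v, (0 : F)) ∈ R → v = 0 := by
    rintro v ⟨g, g', hg, hg', h⟩
    refine central_eq M D hw ht hτ1 hx hg ?_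
    intro b hb
    obtain ⟨b', hb', hbb⟩ := h1 b hb
    obtain ⟨a, ha⟩ := comm_isU M D ht' hx' hb'
    rw [← hπ1, ← map_eq_one_iff ψ ψ.injective, hcomm2 g g' _ _ h (hcomm b b' hbb),
      htriv _ _ _ hg' ha, map_one]
  obtain ⟨v₀, v₁, hv₀, hv₁, hv⟩ : ∃ v₀ v₁, v₀ ≠ 0 ∧ v₁ ≠ 0 ∧ (v₀, v₁) ∈ R := by
    obtain ⟨u, hu⟩ := exists_isU M D 1
    obtain ⟨b', hb', hbb⟩ := h1 u hu.upper
    obtain ⟨a, ha⟩ := comm_isU M D ht' hx' hb'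
    have hm : (t ^ 2 / φ t * 1 + -1, a) ∈ R :=
      ⟨_, _, (hu.conj D ht hx).mul (hu.inv D), ha, hcomm _ _ hbb⟩
    have hne : t ^ 2 / φ t * 1 + -1 ≠ 0 := by
      rw [mul_one, ← sub_eq_add_neg]; exact sub_ne_zero.2 hτ1
    refine ⟨_, a, hne, ?_, hm⟩
    rintro rfl
    exact hne (hfun2 _ hm)
  let S : Subring (F × F) :=
    { carrier := {r | ∀ a ∈ R, r * a ∈ R}
      zero_mem' := by intro a _; rw [zero_mul]; exact R.zero_mem
      one_mem' := by intro a h; rwa [one_mul]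
      add_mem' := by intro r s hr hs a ha; rw [add_mul]; exact R.add_mem (hr a ha) (hs a ha)
      mul_mem' := by intro r s hr hs a ha; rw [mul_assoc]; exact hr _ (hs a ha)
      neg_mem' := by intro r hr a ha; rw [neg_mul]; exact R.neg_mem (hr a ha) }
  have hτS : (t ^ 2 / φ t, (t ^ 2 / φ t)⁻¹) ∈ S := by
    rintro ⟨a, a'⟩ ⟨g, g', hg, hg', h⟩
    refine ⟨x * g * x⁻¹, x⁻¹ * g' * x⁻¹⁻¹, hg.conj D ht hx, ?_, ?_⟩
    · have := hg'.conj D ht' hx'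
      rwa [tau_inv] at this
    · simp only [map_mul, map_inv, h, hψx]
  have huniq : ∀ r', ((0 : F), r') ∈ S → r' = 0 := by
    intro r' h
    have h3 := h _ hv
    have h4 : ((0 : F), r') * (v₀, v₁) = (0, r' * v₁) := by simp
    rw [h4] at h3
    have := hfun _ h3
    simpa [hv₁] using this
  let f : S →+* F := (RingHom.fst F F).comp S.subtype
  have hf : Function.Bijective f := by
    constructor
    · rw [injective_iff_map_eq_zero]
      rintro ⟨⟨r, r'⟩, h⟩ h0
      have h0 : r = 0 := h0
      subst h0
      have := huniq r' h
      subst this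
      rfl
    · rw [← RingHom.range_eq_top]
      apply D.top
      exact ⟨⟨_, hτS⟩, rfl⟩
  let e := RingEquiv.ofBijective f hf
  let σ : F →+* F := ((RingHom.snd F F).comp S.subtype).comp (e.symm : F →+* S)
  apply D.aut σ
  have : e.symm (t ^ 2 / φ t) = ⟨_, hτS⟩ := by
    rw [RingEquiv.symm_apply_eq]; rfl
  change ((e.symm (t ^ 2 / φ t) : S) : F × F).2 = _
  rw [this]

theorem core (M : Model F φ G) (D : FieldData φ t) :
    ∃ x y : G ⧸ Subgroup.center G, Subgroup.closure {x, y} = ⊤ ∧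
      ¬ ∃ ψ : MulAut (G ⧸ Subgroup.center G), ψ x = x⁻¹ ∧ ψ y = y⁻¹ := by
  have ht := D.ne_zero
  have hφt : φ t ≠ 0 := by simpa using ht
  have hkne : t / φ t ≠ 0 := div_ne_zero ht hφt
  obtain ⟨x, hx⟩ := exists_h M D ht
  obtain ⟨w, hw⟩ := M.surj _ (wM_iso φ) wM_det
  obtain ⟨u, hu⟩ := exists_isU M D 1
  set y := u * w * x * u⁻¹ with hy
  set n := w * x * w * x with hn'
  have hn : M.ρ n = hM φ (t / φ t) := by
    rw [← wM_hM_sq φ ht D.invol, hn']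
    simp only [map_mul, hw, hx]
  set z := u * (n * u⁻¹ * n⁻¹) with hz'
  have hyz : y ^ 2 = z * n := by
    rw [hz', hy, hn', pow_two]; group
  obtain ⟨a₀, ha₀, hz⟩ : ∃ a₀, a₀ ≠ 0 ∧ IsU M z a₀ := by
    refine ⟨_, ?_, hu.mul ((hu.inv D).conj D hkne hn)⟩
    intro h
    apply D.cube
    rw [map_div₀, D.invol] at h
    field_simp at h ⊢
    linear_combination -h
  have hB : Subgroup.closure {x, y ^ 2} = borelSub M := by
    apply le_antisymm
    · rw [Subgroup.closure_le]
      rintro g (rfl | rfl)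
      · exact h_upper M hx
      · rw [SetLike.mem_coe, hyz]
        exact mul_mem hz.upper (h_upper M hn)
    · intro g hg
      have hxm : x ∈ Subgroup.closure {x, y ^ 2} := Subgroup.subset_closure (by simp)
      have hym : y ^ 2 ∈ Subgroup.closure {x, y ^ 2} := Subgroup.subset_closure (by simp)
      have hnm := h_mem M D hx hxm hkne hn
      have hzm : z ∈ Subgroup.closure {x, y ^ 2} := by
        have := mul_mem hym (inv_mem hnm)
        rwa [hyz, mul_inv_cancel_right, ← hyz] at this
      exact upper_mem M D hx hxm hzm ha₀ hz hg
  have hG : Subgroup.closure {x, y} = ⊤ := by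
    rw [eq_top_iff]
    intro g _
    have hxm : x ∈ Subgroup.closure {x, y} := Subgroup.subset_closure (by simp)
    have hym : y ∈ Subgroup.closure {x, y} := Subgroup.subset_closure (by simp)
    have hle : borelSub M ≤ Subgroup.closure {x, y} := by
      rw [← hB, Subgroup.closure_le]
      rintro g (rfl | rfl)
      · exact hxm
      · exact pow_mem hym 2
    have hwm : w ∈ Subgroup.closure {x, y} := by
      have h1 := mul_mem (mul_mem (mul_mem (inv_mem (hle hu.upper)) hym) (hle hu.upper))
        (inv_mem hxm)
      have h2 : u⁻¹ * y * u * x⁻¹ = w := by rw [hy]; group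
      rwa [h2] at h1
    rcases bruhat M D hw g with h | ⟨u', b, a, hu', hb, rfl⟩
    · exact hle h
    · exact mul_mem (mul_mem (hle hu'.upper) hwm) (hle hb)
  refine ⟨QuotientGroup.mk' _ x, QuotientGroup.mk' _ y, ?_, ?_⟩
  · have := congrArg (Subgroup.map (QuotientGroup.mk' (Subgroup.center G))) hG
    rw [MonoidHom.map_closure, Set.image_pair, Subgroup.map_top_of_surjective _
      (QuotientGroup.mk'_surjective _)] at this
    exact this
  · rintro ⟨ψ, hψx, hψy⟩
    set π := QuotientGroup.mk' (Subgroup.center G) with hπ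
    have hC : (borelSub M).map π = Subgroup.closure {π x, π y ^ 2} := by
      rw [← hB, MonoidHom.map_closure, Set.image_pair, map_pow]
    have hxm : π x ∈ Subgroup.closure {π x, π y ^ 2} := Subgroup.subset_closure (by simp)
    have hym : π y ^ 2 ∈ Subgroup.closure {π x, π y ^ 2} := Subgroup.subset_closure (by simp)
    have hψy2 : ψ (π y ^ 2) = (π y ^ 2)⁻¹ := by rw [map_pow, hψy, inv_pow]
    have hle1 : ((borelSub M).map π).map ψ.toMonoidHom ≤ (borelSub M).map π := by
      rw [hC, MonoidHom.map_closure, Subgroup.closure_le]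
      rintro _ ⟨g, (rfl | rfl), rfl⟩
      · change ψ (π x) ∈ _
        rw [hψx]; exact inv_mem hxm
      · change ψ (π y ^ 2) ∈ _
        rw [hψy2]; exact inv_mem hym
    have hle2 : (borelSub M).map π ≤ ((borelSub M).map π).map ψ.toMonoidHom := by
      rw [hC, Subgroup.closure_le]
      rintro _ (rfl | rfl)
      · exact ⟨(π x)⁻¹, inv_mem hxm, by change ψ _ = _; rw [map_inv, hψx, inv_inv]⟩
      · exact ⟨(π y ^ 2)⁻¹, inv_mem hym, by change ψ _ = _; rw [map_inv, hψy2, inv_inv]⟩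
    refine no_aut M D hw hx ψ hψx ?_ ?_
    · intro b hb
      obtain ⟨b', hb', h⟩ := hle1 ⟨_, ⟨b, hb, rfl⟩, rfl⟩
      exact ⟨b', hb', h.symm⟩
    · intro b' hb'
      obtain ⟨_, ⟨b, hb, rfl⟩, h⟩ := hle2 ⟨b', hb', rfl⟩
      exact ⟨b, hb, h⟩

end

section
variable {F : Type*} [Field F] [Fintype F]

theorem prim_root {q : ℕ} (hF : Fintype.card F = q ^ 2) :
    ∃ t : F, t ≠ 0 ∧ (∀ s : F, s ≠ 0 → ∃ k : ℕ, t ^ k = s) ∧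
      ∀ n : ℕ, t ^ n = 1 → q ^ 2 - 1 ∣ n := by
  classical
  obtain ⟨g, hg⟩ := IsCyclic.exists_generator (α := Fˣ)
  refine ⟨g, g.ne_zero, ?_, ?_⟩
  · intro s hs
    obtain ⟨k, hk⟩ := (mem_powers_iff_mem_zpowers).2 (hg (Units.mk0 s hs))
    refine ⟨k, ?_⟩
    have := congrArg Units.val hk
    simpa using this
  · intro n hn
    have h1 : g ^ n = 1 := by ext; simpa using hn
    have h2 := orderOf_dvd_of_pow_eq_one h1
    rwa [orderOf_eq_card_of_forall_mem_zpowers hg, Nat.card_eq_fintype_card, Fintype.card_units,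
      hF] at h2

theorem not_dvd_aux {q n : ℕ} (hq2 : 2 < q) (hn : 0 < n) (hn' : n ≤ 3 * (q - 1)) :
    ¬ q ^ 2 - 1 ∣ n := by
  intro h
  have h1 := Nat.le_of_dvd hn h
  obtain ⟨r, rfl⟩ : ∃ r, q = r + 3 := ⟨q - 3, by omega⟩
  have h2 : (r + 3) ^ 2 - 1 = r * r + 6 * r + 8 := by
    have : (r + 3) ^ 2 = r * r + 6 * r + 9 := by ring
    omega
  rw [h2] at h1
  have : 0 ≤ r * r := Nat.zero_le _
  omega

theorem subring_top {q : ℕ} (hq2 : 2 < q) (hF : Fintype.card F = q ^ 2) {t : F}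
    (hord : ∀ n : ℕ, t ^ n = 1 → q ^ 2 - 1 ∣ n) (S : Subring F) (hS : t ^ 3 ∈ S)
    (ht : t ≠ 0) : S = ⊤ := by
  classical
  by_contra hne
  obtain ⟨v, hv⟩ : ∃ v, v ∉ S := by
    by_contra! h
    exact hne (by ext z; simpa using h z)
  have hinv : ∀ r ∈ S, r⁻¹ ∈ S := by
    intro r hr
    by_cases h0 : r = 0
    · rw [h0, inv_zero]; exact S.zero_mem
    have h1 := FiniteField.pow_card_sub_one_eq_one r h0
    have h2 : r⁻¹ = r ^ (Fintype.card F - 2) := by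
      rw [inv_eq_iff_eq_inv, eq_comm]
      apply inv_eq_of_mul_eq_one_left
      rw [← pow_succ', ← h1]
      congr 1
      have : 9 ≤ Fintype.card F := by rw [hF]; nlinarith
      omega
    rw [h2]; exact pow_mem hr _
  have hinj : Function.Injective (fun p : S × S => (p.1 : F) + p.2 * v) := by
    rintro ⟨a, b⟩ ⟨a', b'⟩ h
    simp only at h
    have hb : b = b' := by
      by_contra hb
      have hb' : (b : F) - b' ≠ 0 := fun h => hb (Subtype.ext (sub_eq_zero.1 h))
      apply hv
      have : v = ((a' : F) - a) * ((b : F) - b')⁻¹ := by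
        field_simp
        linear_combination h
      rw [this]
      exact S.mul_mem (S.sub_mem a'.2 a.2) (hinv _ (S.sub_mem b.2 b'.2))
    subst hb
    have : a = a' := Subtype.ext (by linear_combination h)
    rw [this]
  have hcard := Fintype.card_le_of_injective _ hinj
  rw [Fintype.card_prod, hF, ← pow_two] at hcard
  have hle : Fintype.card S ≤ q := (Nat.pow_le_pow_iff_left (by norm_num)).1 hcard
  have hgt : 1 < Fintype.card S := Fintype.one_lt_card
  have hpow : (t ^ 3) ^ (Fintype.card S - 1) = 1 := by
    let := Fintype.fieldOfDomain S
    have h := FiniteField.pow_card_sub_one_eq_one (⟨t ^ 3, hS⟩ : S) (by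
      intro h
      have := congrArg Subtype.val h
      exact pow_ne_zero 3 ht this)
    exact congrArg Subtype.val h
  rw [← pow_mul] at hpow
  exact not_dvd_aux hq2 (by omega) (by omega) (hord _ hpow)

theorem invol_aut (p : ℕ) [Fact p.Prime] [Algebra (ZMod p) F] (φ σ : F →+* F)
    (hφ : ∀ x, φ (φ x) = x) (hσ : ∀ x, σ (σ x) = x) (hφ1 : ∃ x, φ x ≠ x) :
    (∀ x, σ x = x) ∨ (∀ x, σ x = φ x) := by
  classical
  let A (f : F →+* F) (hf : ∀ x, f (f x) = x) : F ≃ₐ[ZMod p] F :=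
    AlgEquiv.ofRingEquiv (f := RingEquiv.ofRingHom f f (by ext; simp [hf]) (by ext; simp [hf]))
      (fun r => RingHom.congr_fun
        (Subsingleton.elim (f.comp (algebraMap (ZMod p) F)) (algebraMap (ZMod p) F)) r)
  have hA : ∀ f hf x, A f hf x = f x := fun f hf x => rfl
  have : Finite (F ≃ₐ[ZMod p] F) := inferInstance
  let : Fintype (F ≃ₐ[ZMod p] F) := Fintype.ofFinite _
  have hA2 : ∀ f hf, A f hf ^ 2 = 1 := by
    intro f hf
    ext x
    simp [pow_two, hA, hf]
  have hc := IsCyclic.card_pow_eq_one_le (α := F ≃ₐ[ZMod p] F) (n := 2) (by norm_num)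
  by_contra! h
  obtain ⟨⟨a, ha⟩, ⟨b, hb⟩⟩ := h
  obtain ⟨c, hc'⟩ := hφ1
  have h1 : A σ hσ ≠ 1 := fun h => ha (by rw [← hA σ hσ, h]; rfl)
  have h2 : A σ hσ ≠ A φ hφ := fun h => hb (by rw [← hA σ hσ, h, hA φ hφ])
  have h3 : A φ hφ ≠ 1 := fun h => hc' (by rw [← hA φ hφ, h]; rfl)
  have hsub : ({1, A φ hφ, A σ hσ} : Finset (F ≃ₐ[ZMod p] F)) ⊆
      Finset.univ.filter (fun g => g ^ 2 = 1) := by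
    intro g hg
    simp only [Finset.mem_insert, Finset.mem_singleton] at hg
    rcases hg with rfl | rfl | rfl <;> simp [hA2]
  have h4 := Finset.card_le_card hsub
  rw [Finset.card_eq_three.2 ⟨_, _, _, h3.symm, h1.symm, h2.symm, rfl⟩] at h4
  omega

theorem field_data {q : ℕ} (hq2 : 2 < q) (hF : Fintype.card F = q ^ 2)
    (φ : F →+* F) (hφ : ∀ x : F, φ x = x ^ q) :
    ∃ t : F, FieldData φ t ∧ ∃ z : F, z * φ z = -1 := by
  obtain ⟨t, ht, hgen, hord⟩ := prim_root hF
  have hinv : ∀ x, φ (φ x) = x := by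
    intro x
    rw [hφ, hφ, ← pow_mul, ← pow_two, ← hF, FiniteField.pow_card]
  have hφt : φ t ≠ 0 := by simpa using ht
  have htq : t ^ q ≠ 0 := pow_ne_zero _ ht
  have hqq : t ^ (q ^ 2) = t := by rw [← hF, FiniteField.pow_card]
  have hcancel : ∀ m n : ℕ, n ≤ m → t ^ m = t ^ n → q ^ 2 - 1 ∣ m - n := by
    intro m n hmn h
    apply hord
    have h1 : t ^ n ≠ 0 := pow_ne_zero _ ht
    apply mul_left_cancel₀ h1
    rw [← pow_add, mul_one, Nat.add_sub_cancel' hmn, h]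
  have htne : φ t ≠ t := by
    intro h
    rw [hφ] at h
    exact not_dvd_aux hq2 (by omega) (by omega) (hcancel q 1 (by omega) (by rwa [pow_one]))
  have htop : ∀ S : Subring F, t ^ 2 / φ t ∈ S → S = ⊤ := by
    intro S hS
    refine subring_top hq2 hF hord S ?_ ht
    have h1 : (t ^ 2 / φ t) ^ (q + 2) = t ^ 3 := by
      have e1 : (t ^ 2) ^ (q + 2) = t ^ (2 * q) * t ^ 4 := by
        rw [← pow_mul, ← pow_add]; congr 1 <;> ring
      have e2 : (t ^ q) ^ (q + 2) = t ^ (2 * q) * t ^ (q ^ 2) := by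
        rw [← pow_mul, ← pow_add]; congr 1 <;> ring
      have h2 : t ^ (2 * q) ≠ 0 := pow_ne_zero _ ht
      rw [hφ, div_pow, e1, e2, hqq]
      field_simp
    rw [← h1]
    exact pow_mem hS _
  have hqge : q ≤ q ^ 2 := by nlinarith
  refine ⟨t, ⟨hinv, ht, hgen, htop, ?_, htne, ?_, ?_⟩, ?_⟩
  · have : ∃ c : F, c + φ c ≠ 0 := by
      by_contra! h
      have h1 := h 1
      have h2 := h t
      apply htne
      rw [map_one] at h1
      linear_combination h2 - t * h1
    obtain ⟨c, hc⟩ := this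
    refine ⟨c / (c + φ c), ?_⟩
    rw [map_div₀, map_add, hinv, add_comm (φ c) c, ← add_div, div_self hc]
  · intro h
    rw [div_pow, div_eq_one_iff_eq (pow_ne_zero _ hφt), hφ, ← pow_mul] at h
    exact not_dvd_aux hq2 (by omega) (by omega) (hcancel (q * 3) 3 (by omega) h.symm)
  · intro σ hσ
    have hσσ : ∀ x, σ (σ x) = x := by
      have h1 : (σ.comp σ).eqLocus (RingHom.id F) = ⊤ := by
        apply htop
        change σ (σ _) = _
        rw [hσ, map_inv₀, hσ, inv_inv]
        rfl
      intro x
      have : x ∈ (σ.comp σ).eqLocus (RingHom.id F) := by rw [h1]; trivial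
      exact this
    obtain ⟨p, hp⟩ := CharP.exists F
    have : Fact p.Prime := ⟨CharP.char_is_prime F p⟩
    let : Algebra (ZMod p) F := ZMod.algebra F p
    rcases invol_aut p φ σ hinv hσσ ⟨t, htne⟩ with h | h
    · rw [h, inv_div, div_eq_div_iff hφt (pow_ne_zero _ ht), hφ, ← pow_add, ← pow_add] at hσ
      exact not_dvd_aux hq2 (by omega) (by omega) (hcancel (q + q) (2 + 2) (by omega) hσ.symm)
    · rw [h, inv_div, map_div₀, hinv, map_pow, div_eq_div_iff ht (pow_ne_zero _ ht)] at hσ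
      have h2 : φ t * (t * (t * φ t)) = φ t * (t * 1) := by linear_combination hσ
      have h3 := mul_left_cancel₀ ht (mul_left_cancel₀ hφt h2)
      rw [hφ, ← pow_succ'] at h3
      exact not_dvd_aux hq2 (by omega) (by omega) (hord _ h3)
  · rcases Nat.even_or_odd q with he | ho
    · refine ⟨1, ?_⟩
      have h1 : (-1 : F) ^ (q ^ 2) = -1 := by rw [← hF, FiniteField.pow_card]
      rw [Even.neg_one_pow (he.pow_of_ne_zero (by norm_num))] at h1
      simpa using h1
    · obtain ⟨j, hj⟩ := ho
      obtain ⟨k, hk⟩ := hgen (-1) (by simp)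
      have h1 : t ^ (2 * k) = 1 := by rw [mul_comm, pow_mul, hk]; norm_num
      obtain ⟨m, hm⟩ := hord _ h1
      have hq' : q ^ 2 - 1 = 2 * (j * (q + 1)) := by
        subst hj
        have : (2 * j + 1) ^ 2 = 2 * (j * (2 * j + 1 + 1)) + 1 := by ring
        omega
      have hk' : k = j * m * (q + 1) := by
        rw [hq'] at hm
        have : 2 * k = 2 * (j * m * (q + 1)) := by rw [hm]; ring
        omega
      refine ⟨t ^ (j * m), ?_⟩
      rw [hφ, ← pow_succ', ← pow_mul, ← hk', hk]

end

theorem exists_model {F : Type*} [Field F] {φ : F →+* F} {t z : F} (D : FieldData φ t)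
    (hz : z * φ z = -1) : Nonempty (Model F φ (SU3 F φ)) := by
  have ht := D.ne_zero
  have hφt : φ t ≠ 0 := by simpa using ht
  have hz0 : z ≠ 0 := by rintro rfl; simp at hz
  have hd : φ t - t ≠ 0 := sub_ne_zero.2 D.t_ne
  have hd' : t - φ t ≠ 0 := sub_ne_zero.2 D.t_ne.symm
  let k : F := φ t / (φ t - t)
  let P : Matrix (Fin 3) (Fin 3) F := !![1, 0, k; z, 0, k * (z * (t / φ t)); 0, 1, 0]
  have hP : starM φ P * P = jM F := by
    simp only [P, k, jM, starM_of, Matrix.mul_fin_three, map_mul, map_div₀, map_sub, D.invol,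
      map_one, map_zero]
    apply m3_ext
    · linear_combination hz
    · ring
    · field_simp
      linear_combination t * hz
    · ring
    · ring
    · ring
    · field_simp
      linear_combination (φ t) * hz
    · ring
    · field_simp
      linear_combination (t * φ t) * hz
  have hjj : jM F * jM F = 1 := by
    simp [jM, Matrix.one_fin_three]
  have hQP : jM F * starM φ P * P = 1 := by rw [mul_assoc, hP, hjj]
  have hPQ : P * (jM F * starM φ P) = 1 := mul_eq_one_comm.1 hQP
  generalize jM F * starM φ P = Q at hQP hPQ
  have hst1 : starM φ (1 : Matrix (Fin 3) (Fin 3) F) = 1 := by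
    simp [starM, Matrix.map_one φ (map_zero φ) (map_one φ)]
  have hQsPs : starM φ Q * starM φ P = 1 := by rw [← starM_mul, hPQ, hst1]
  have hPsQs : starM φ P * starM φ Q = 1 := by rw [← starM_mul, hQP, hst1]
  have hdet : Q.det * P.det = 1 := by rw [← Matrix.det_mul, hQP, Matrix.det_one]
  refine ⟨⟨⟨⟨fun g => Q * (g : Matrix.SpecialLinearGroup (Fin 3) F).1 * P, ?_⟩, ?_⟩,
    ?_, ?_, ?_, ?_⟩⟩
  · change Q * 1 * P = 1
    rw [mul_one, hQP]
  · intro g g'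
    change Q * ((g : Matrix.SpecialLinearGroup (Fin 3) F).1 *
      (g' : Matrix.SpecialLinearGroup (Fin 3) F).1) * P =
      (Q * (g : Matrix.SpecialLinearGroup (Fin 3) F).1 * P) *
      (Q * (g' : Matrix.SpecialLinearGroup (Fin 3) F).1 * P)
    generalize (g : Matrix.SpecialLinearGroup (Fin 3) F).1 = a
    generalize (g' : Matrix.SpecialLinearGroup (Fin 3) F).1 = b
    calc Q * (a * b) * P = Q * a * 1 * b * P := by noncomm_ring
      _ = _ := by rw [← hPQ]; noncomm_ring
  · intro g g' h
    change Q * (g : Matrix.SpecialLinearGroup (Fin 3) F).1 * P =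
      Q * (g' : Matrix.SpecialLinearGroup (Fin 3) F).1 * P at h
    apply Subtype.ext
    apply Subtype.ext
    have h2 : ∀ a : Matrix (Fin 3) (Fin 3) F, P * (Q * a * P) * Q = a := by
      intro a
      calc P * (Q * a * P) * Q = (P * Q) * a * (P * Q) := by noncomm_ring
        _ = a := by rw [hPQ, one_mul, mul_one]
    rw [← h2 (g : Matrix.SpecialLinearGroup (Fin 3) F).1, h, h2]
  · intro g
    change starM φ (Q * (g : Matrix.SpecialLinearGroup (Fin 3) F).1 * P) * jM F *
      (Q * (g : Matrix.SpecialLinearGroup (Fin 3) F).1 * P) = jM F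
    have hg : starM φ (g : Matrix.SpecialLinearGroup (Fin 3) F).1 *
      (g : Matrix.SpecialLinearGroup (Fin 3) F).1 = 1 := g.2
    generalize (g : Matrix.SpecialLinearGroup (Fin 3) F).1 = a at *
    rw [starM_mul, starM_mul, ← hP]
    calc starM φ P * (starM φ a * starM φ Q) * (starM φ P * P) * (Q * a * P)
        = starM φ P * (starM φ a * (starM φ Q * starM φ P) * (P * Q) * a) * P := by noncomm_ring
      _ = _ := by rw [hQsPs, hPQ, mul_one, mul_one, hg, mul_one]
  · intro g
    change (Q * (g : Matrix.SpecialLinearGroup (Fin 3) F).1 * P).det = 1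
    rw [Matrix.det_mul, Matrix.det_mul, (g : Matrix.SpecialLinearGroup (Fin 3) F).2, mul_one, hdet]
  · intro m hm hmd
    refine ⟨⟨⟨P * m * Q, ?_⟩, ?_⟩, ?_⟩
    · rw [Matrix.det_mul, Matrix.det_mul, hmd, mul_one, mul_comm, hdet]
    · change starM φ (P * m * Q) * (P * m * Q) = 1
      rw [starM_mul, starM_mul]
      calc starM φ Q * (starM φ m * starM φ P) * (P * m * Q)
          = starM φ Q * (starM φ m * (starM φ P * P) * m) * Q := by noncomm_ring
        _ = starM φ Q * (starM φ P * P) * Q := by rw [hP, hm]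
        _ = (starM φ Q * starM φ P) * (P * Q) := by noncomm_ring
        _ = 1 := by rw [hQsPs, hPQ, one_mul]
    · change Q * (P * m * Q) * P = m
      calc Q * (P * m * Q) * P = (Q * P) * m * (Q * P) := by noncomm_ring
        _ = m := by rw [hQP, one_mul, mul_one]

/-- For every prime power `q > 2`, the group `PSU(3, q) = SU(3, q)/Z(SU(3, q))` is not
strongly symmetric: there is a generating pair `x, y` of `PSU(3, q)` such that no
automorphism of `PSU(3, q)` inverts both `x` and `y`.  Here `F` is the field with `q²`
elements and `φ : x ↦ x ^ q` is its Frobenius automorphism over `F_q`. -/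
theorem psu_three_not_strongly_symmetric
    (q : ℕ) (hq : IsPrimePow q) (hq2 : 2 < q)
    (F : Type*) [Field F] [Fintype F] (hF : Fintype.card F = q ^ 2)
    (φ : F →+* F) (hφ : ∀ x : F, φ x = x ^ q) :
    ¬ StronglySymmetric (SU3 F φ ⧸ Subgroup.center (SU3 F φ)) ∧
      ∃ x y : SU3 F φ ⧸ Subgroup.center (SU3 F φ),
        Subgroup.closure {x, y} = ⊤ ∧
          ¬∃ ψ : MulAut (SU3 F φ ⧸ Subgroup.center (SU3 F φ)),
            ψ x = x⁻¹ ∧ ψ y = y⁻¹ := by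
  obtain ⟨t, D, z, hz⟩ := field_data hq2 hF φ hφ
  obtain ⟨M⟩ := exists_model D hz
  obtain ⟨x, y, hxy, hno⟩ := core M D
  exact ⟨fun h => hno (h.2 x y hxy), x, y, hxy, hno⟩
end

section
/- For every prime power q with q > 2 there exists a matrix g in the general unitary group GU(3,q) = { g ∈ GL(3, F_{q²}) : (g^φ)ᵀ · g = 1 } such that g^φ = g⁻¹ and g has multiplicative order q² − q + 1, where g^φ denotes the matrix obtained from g by applying the field automorphism x ↦ x^q of F_{q²} to each entry. -/
open scoped Matrix MatrixGroups

/-- An element `ζ` inverted by `σ`, written in an orthogonal `σ`-fixed basis. -/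
lemma aux_final {F L : Type*} [Field F] [Field L] [Algebra F L]
    (h3 : Module.finrank F L = 3) (φ : F →+* F) (σ : L →+* L)
    (hσ : ∀ x : F, σ (algebraMap F L x) = algebraMap F L (φ x))
    (v : Fin 3 → L) (hv : ∀ i, σ (v i) = v i) (l : L →ₗ[F] F) (c : F) (hc : c ≠ 0)
    (hl : ∀ i j, l (v i * v j) = if i = j then c else 0)
    (ζ : Lˣ) (hζ : σ ζ = ((ζ⁻¹ : Lˣ) : L)) :
    ∃ g : GL (Fin 3) F,
      ((g : Matrix (Fin 3) (Fin 3) F).map φ)ᵀ * (g : Matrix (Fin 3) (Fin 3) F) = 1 ∧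
        (g : Matrix (Fin 3) (Fin 3) F).map φ =
          ((g⁻¹ : GL (Fin 3) F) : Matrix (Fin 3) (Fin 3) F) ∧
        orderOf g = orderOf ζ := by
  have key : ∀ (a : Fin 3 → F) (i : Fin 3), l (v i * ∑ j, a j • v j) = c * a i := by
    intro a i
    simp only [Finset.mul_sum, mul_smul_comm, map_sum, map_smul, hl, smul_eq_mul]
    simp [mul_comm]
  have hli : LinearIndependent F v := by
    rw [Fintype.linearIndependent_iff]
    intro a ha i
    have := key a i
    rw [ha, mul_zero, map_zero] at this
    exact (mul_eq_zero.mp this.symm).resolve_left hc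
  let b : Module.Basis (Fin 3) F L := basisOfLinearIndependentOfCardEqFinrank hli (by simp [h3])
  have hb : ∀ i, b i = v i := fun i => by simp [b]
  have hrepr : ∀ (x : L) (i : Fin 3), c * b.repr x i = l (v i * x) := by
    intro x i
    rw [← key (fun j => b.repr x j) i]
    congr 2
    conv_rhs => rw [← b.sum_repr x]
    simp [hb]
  let M := Algebra.leftMulMatrix b
  have hsymm : ∀ x : L, (M x)ᵀ = M x := by
    intro x
    ext i j
    apply mul_left_cancel₀ hc
    simp only [M, Matrix.transpose_apply, Algebra.leftMulMatrix_eq_repr_mul, hrepr, hb]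
    congr 1
    ring
  have hmap : ∀ x : L, (M x).map φ = M (σ x) := by
    intro x
    ext i j
    simp only [M, Matrix.map_apply, Algebra.leftMulMatrix_eq_repr_mul]
    have h1 : σ x * b j = ∑ i, φ (b.repr (x * b j) i) • b i := by
      have h2 : σ (x * b j) = σ x * b j := by rw [map_mul, hb, hv]
      rw [← h2]
      conv_lhs => rw [← b.sum_repr (x * b j)]
      simp only [map_sum, Algebra.smul_def, map_mul, hσ, hb, hv]
    rw [h1, b.repr_sum_self]
  let f : Lˣ →* GL (Fin 3) F := Units.map (M : L →* Matrix (Fin 3) (Fin 3) F)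
  have hf : ∀ u : Lˣ, ((f u : GL (Fin 3) F) : Matrix (Fin 3) (Fin 3) F) = M u := fun u => rfl
  have hm : ((f ζ : GL (Fin 3) F) : Matrix (Fin 3) (Fin 3) F).map φ =
          (((f ζ)⁻¹ : GL (Fin 3) F) : Matrix (Fin 3) (Fin 3) F) := by
    rw [← map_inv, hf, hf, hmap, hζ]
  refine ⟨f ζ, ?_, hm, ?_⟩
  · rw [hm, ← map_inv, hf, hf, hsymm, ← map_mul]
    simp
  · apply orderOf_injective
    intro u w h
    apply Units.ext
    apply Algebra.leftMulMatrix_injective b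
    exact congrArg Units.val h

/-- Existence of the orthogonal basis. -/
lemma aux_basis {F L : Type*} [Field F] [Finite F] [Field L] [Algebra F L]
    (p : ℕ) [Fact p.Prime] [CharP F p] (φ : F →+* F) (σ : L →+* L)
    (hσ : ∀ x : F, σ (algebraMap F L x) = algebraMap F L (φ x))
    (α : L) (hα : σ α = α) (e : Module.Basis (Fin 3) F L) (he : ∀ i, e i = α ^ (i : ℕ)) :
    ∃ (v : Fin 3 → L) (l : L →ₗ[F] F) (c : F), (∀ i, σ (v i) = v i) ∧ c ≠ 0 ∧
      ∀ i j, l (v i * v j) = if i = j then c else 0 := by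
  let l : L →ₗ[F] F := e.coord 2
  have hlσ : ∀ x, l (σ x) = φ (l x) := by
    intro x
    have h1 : σ x = ∑ i, φ (e.repr x i) • e i := by
      conv_lhs => rw [← e.sum_repr x]
      simp only [map_sum, Algebra.smul_def, map_mul, hσ, he, map_pow, hα]
    simp only [l, Module.Basis.coord_apply]
    rw [h1, e.repr_sum_self]
  have l0 : l 1 = 0 := by
    have := he 0
    simp only [Fin.val_zero, pow_zero] at this
    rw [← this]; simp [l]
  have l1 : l α = 0 := by
    have := he 1
    simp only [Fin.val_one, pow_one] at this
    rw [← this]; simp [l]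
  have l2 : l (α ^ 2) = 1 := by
    have := he 2
    simp only [Fin.val_two] at this
    rw [← this]; simp [l]
  obtain ⟨a, ha⟩ : ∃ a, l (α ^ 3) = a := ⟨_, rfl⟩
  obtain ⟨b, hb⟩ : ∃ b, l (α ^ 4) = b := ⟨_, rfl⟩
  have hφa : φ a = a := by rw [← ha, ← hlσ, map_pow, hα]
  have hφb : φ b = b := by rw [← hb, ← hlσ, map_pow, hα]
  -- the general product formula
  let w : F → F → F → L := fun x y z =>
    algebraMap F L x + algebraMap F L y * α + algebraMap F L z * α ^ 2
  have hw : ∀ x y z x2 y2 z2, l (w x y z * w x2 y2 z2) =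
      x * z2 + z * x2 + y * y2 + (y * z2 + z * y2) * a + z * z2 * b := by
    intro x y z x2 y2 z2
    have : w x y z * w x2 y2 z2 = (x * x2) • (1 : L) + (x * y2 + y * x2) • α +
        (x * z2 + z * x2 + y * y2) • α ^ 2 + (y * z2 + z * y2) • α ^ 3 + (z * z2) • α ^ 4 := by
      simp only [w, Algebra.smul_def, map_add, map_mul]
      ring
    rw [this]
    simp only [map_add, map_smul, l0, l1, l2, ha, hb, smul_eq_mul]
    ring
  have hwσ : ∀ x y z, φ x = x → φ y = y → φ z = z → σ (w x y z) = w x y z := by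
    intro x y z hx hy hz
    simp only [w, map_add, map_mul, map_pow, hσ, hα, hx, hy, hz]
  by_cases h2 : (2 : F) = 0
  · have hch : ringChar F = 2 := by
      have : CharP F (ringChar F) := ringChar.charP F
      have h := (ringChar.spec F 2).mp (by exact_mod_cast h2)
      exact (Nat.prime_dvd_prime_iff_eq (CharP.char_is_prime F (ringChar F)) Nat.prime_two).mp h
    obtain ⟨t, ht⟩ := FiniteField.isSquare_of_char_two hch (b + 1)
    have hφt : φ t = t := by
      have h : (φ t - t) ^ 2 = 0 := by
        have h3 : φ t * φ t = t * t := by rw [← map_mul, ← ht, map_add, hφb, map_one]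
        linear_combination h3 + (t ^ 2 - φ t * t) * h2
      exact sub_eq_zero.mp (pow_eq_zero_iff (two_ne_zero) |>.mp h)
    refine ⟨![w 0 t 1, w 1 t 1, w (a + t) 1 0], l, 1, ?_, one_ne_zero, ?_⟩
    · intro i
      fin_cases i <;> simp [hwσ, hφa, hφt]
    · intro i j
      fin_cases i <;> fin_cases j <;> simp [hw] <;> grind
  · obtain ⟨A₀, B₀, hAB⟩ := ZMod.sq_add_sq p (-1)
    obtain ⟨A, B, hφA, hφB, hAB⟩ : ∃ A B : F, φ A = A ∧ φ B = B ∧ A ^ 2 + B ^ 2 = -1 := by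
      refine ⟨(A₀.val : F), (B₀.val : F), map_natCast _ _, map_natCast _ _, ?_⟩
      have := congrArg (ZMod.castHom (dvd_refl p) F) hAB
      simpa using this
    have hφ2 : φ 2⁻¹ = 2⁻¹ := by rw [map_inv₀, map_ofNat]
    obtain ⟨h, hh, hφh⟩ : ∃ h : F, 2 * h = 1 ∧ φ h = h := ⟨2⁻¹, mul_inv_cancel₀ h2, hφ2⟩
    -- `f3 = s + t α + α ^ 2`
    obtain ⟨s, hs, hφs⟩ : ∃ s : F, 2 * s = a ^ 2 - b ∧ φ s = s :=
      ⟨h * (a ^ 2 - b), by linear_combination (a ^ 2 - b) * hh, by simp [hφh, hφa, hφb]⟩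
    refine ⟨![w (-h + s) (-a) 1, w (h * A + A * s) (A * (-a) - B) A,
      w (h * B + B * s) (B * (-a) + A) B], l, -1, ?_, by simp, ?_⟩
    · intro i
      fin_cases i <;> simp [hwσ, hφa, hφA, hφB, hφs, hφh]
    · intro i j
      fin_cases i <;> fin_cases j <;> simp [hw] <;> grind

lemma aux_zeta {L : Type*} [Field L] [Finite L] (q : ℕ) (hq : 2 < q)
    (hL : Nat.card L = (q ^ 2) ^ 3) : ∃ ζ : Lˣ, orderOf ζ = q ^ 2 - q + 1 := by
  obtain ⟨g, hg⟩ := IsCyclic.exists_ofOrder_eq_natCard (α := Lˣ)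
  have hcard : orderOf g = (q ^ 2 - q + 1) * ((q + 1) * (q ^ 3 - 1)) := by
    rw [hg, Nat.card_units, hL]
    have h1 : q ≤ q ^ 2 := by nlinarith
    have h2 : 1 ≤ q ^ 3 := Nat.one_le_pow _ _ (by omega)
    have h3 : 1 ≤ (q ^ 2) ^ 3 := Nat.one_le_pow _ _ (by positivity)
    zify [h1, h2, h3]
    ring
  have hpos : 0 < (q + 1) * (q ^ 3 - 1) := by
    have : 1 < q ^ 3 := Nat.one_lt_pow (by norm_num) (by omega)
    have : 0 < q ^ 3 - 1 := by omega
    positivity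
  refine ⟨g ^ ((q + 1) * (q ^ 3 - 1)), ?_⟩
  rw [orderOf_pow_of_dvd hpos.ne' (hcard ▸ dvd_mul_left _ _), hcard, Nat.mul_div_cancel _ hpos]

lemma aux_main (p q : ℕ) (hq2 : 2 < q) [Fact p.Prime]
    {F L : Type*} [Field F] [Fintype F] [CharP F p] (hF : Fintype.card F = q ^ 2)
    [Field L] [Algebra F L] (h3 : Module.finrank F L = 3)
    (φ : F →+* F) (hφ : ∀ x : F, φ x = x ^ q) (σ τ : L →+* L)
    (hσd : ∀ x : L, σ x = x ^ (q ^ 3)) (hτd : ∀ x : L, τ x = x ^ (q ^ 2))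
    (ζ : Lˣ) (hζ : orderOf ζ = q ^ 2 - q + 1) :
    ∃ g : GL (Fin 3) F,
      ((g : Matrix (Fin 3) (Fin 3) F).map φ)ᵀ * (g : Matrix (Fin 3) (Fin 3) F) = 1 ∧
        (g : Matrix (Fin 3) (Fin 3) F).map φ =
          ((g⁻¹ : GL (Fin 3) F) : Matrix (Fin 3) (Fin 3) F) ∧
        orderOf g = q ^ 2 - q + 1 := by
  have hFq : ∀ x : F, x ^ (q ^ 2) = x := fun x => by rw [← hF]; exact FiniteField.pow_card x
  have hσ : ∀ x : F, σ (algebraMap F L x) = algebraMap F L (φ x) := by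
    intro x
    rw [hσd, hφ, ← map_pow, pow_succ q 2, pow_mul, hFq]
  have hτ : ∀ x : F, τ (algebraMap F L x) = algebraMap F L x := by
    intro x
    rw [hτd, ← map_pow, hFq]
  have hqq : q ≤ q ^ 2 := by nlinarith
  have hqq2 : 3 * q ≤ q ^ 2 := by nlinarith
  have hζσ : σ ζ = ((ζ⁻¹ : Lˣ) : L) := by
    rw [hσd, ← Units.val_pow_eq_pow_val]
    congr 1
    rw [eq_inv_iff_mul_eq_one, ← pow_succ]
    apply orderOf_dvd_iff_pow_eq_one.mp
    rw [hζ]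
    refine ⟨q + 1, ?_⟩
    zify [hqq]
    ring
  have hζσi : σ ((ζ⁻¹ : Lˣ) : L) = ζ := by
    rw [Units.val_inv_eq_inv_val, map_inv₀, hζσ, Units.val_inv_eq_inv_val, inv_inv]
  let α : L := ζ + ((ζ⁻¹ : Lˣ) : L)
  have hα : σ α = α := by simp only [α, map_add, hζσ, hζσi, add_comm]
  have hαF : α ∉ (algebraMap F L).range := by
    rintro ⟨x, hx⟩
    have h := hτ x
    rw [hx] at h
    have hz : (ζ : L) * ((ζ⁻¹ : Lˣ) : L) = 1 := by simp
    have hz2 : τ ζ * τ ((ζ⁻¹ : Lˣ) : L) = 1 := by rw [← map_mul, hz, map_one]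
    simp only [α, map_add] at h
    have hprod : (τ ζ - ζ) * (τ ζ - ((ζ⁻¹ : Lˣ) : L)) = 0 := by
      linear_combination (τ ζ) * h - hz2 + hz
    rw [mul_eq_zero, sub_eq_zero, sub_eq_zero, hτd] at hprod
    rcases hprod with h1 | h1
    · rw [← Units.val_pow_eq_pow_val] at h1
      have h1 := Units.ext h1
      have h4 : ζ ^ (q ^ 2 - 1) = 1 := by
        apply mul_right_cancel (b := ζ)
        rw [← pow_succ, Nat.sub_add_cancel (by omega), h1, one_mul]
      have h5 := orderOf_dvd_iff_pow_eq_one.mpr h4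
      rw [hζ] at h5
      have h6 : q ^ 2 - q + 1 ∣ q - 2 := by
        have h7 := Nat.dvd_sub h5 (dvd_refl _)
        have h8 : q ^ 2 - 1 - (q ^ 2 - q + 1) = q - 2 := by omega
        rwa [h8] at h7
      have := Nat.le_of_dvd (by omega) h6
      omega
    · rw [← Units.val_pow_eq_pow_val] at h1
      have h1 := Units.ext h1
      rw [eq_inv_iff_mul_eq_one, ← pow_succ] at h1
      have h5 := orderOf_dvd_iff_pow_eq_one.mpr h1
      rw [hζ] at h5
      have h6 : q ^ 2 - q + 1 ∣ q := by
        have h7 := Nat.dvd_sub h5 (dvd_refl _)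
        have h8 : q ^ 2 + 1 - (q ^ 2 - q + 1) = q := by omega
        rwa [h8] at h7
      have := Nat.le_of_dvd (by omega) h6
      omega
  clear_value α
  have : FiniteDimensional F L := Module.finite_of_finrank_pos (by omega)
  have hdeg : (minpoly F α).natDegree = 3 := by
    have hd : (minpoly F α).natDegree ∣ 3 := h3 ▸ minpoly.degree_dvd (Algebra.IsIntegral.isIntegral α)
    rcases (Nat.dvd_prime Nat.prime_three).mp hd with h | h
    · exact absurd (minpoly.natDegree_eq_one_iff.mp h) hαF
    · exact h
  have hli : LinearIndependent F (fun i : Fin 3 => α ^ (i : ℕ)) := by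
    have := linearIndependent_pow (K := F) α
    rw [hdeg] at this
    exact this
  let e : Module.Basis (Fin 3) F L := basisOfLinearIndependentOfCardEqFinrank hli (by simp [h3])
  have he : ∀ i, e i = α ^ (i : ℕ) := fun i => by simp [e]
  obtain ⟨v, l, c, hv, hc, hl⟩ := aux_basis p φ σ hσ α hα e he
  rw [← hζ]
  exact aux_final h3 φ σ hσ v hv l c hc hl ζ hζσ

/-- For every prime power `q > 2` there exists `g` in the general unitary group
`GU(3, q) = { g ∈ GL(3, F_{q²}) : (g^φ)ᵀ * g = 1 }` with `g^φ = g⁻¹` and of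
multiplicative order exactly `q² - q + 1`.  Here `F` is the field with `q²` elements,
`φ : x ↦ x ^ q` is its Frobenius automorphism over `F_q`, and `g^φ` denotes the
entrywise application of `φ` to `g`. -/
theorem exists_unitary_element_inverted_by_frobenius
    (q : ℕ) (hq : IsPrimePow q) (hq2 : 2 < q)
    (F : Type*) [Field F] [Fintype F] (hF : Fintype.card F = q ^ 2)
    (φ : F →+* F) (hφ : ∀ x : F, φ x = x ^ q) :
    ∃ g : GL (Fin 3) F,
      ((g : Matrix (Fin 3) (Fin 3) F).map φ)ᵀ * (g : Matrix (Fin 3) (Fin 3) F) = 1 ∧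
        (g : Matrix (Fin 3) (Fin 3) F).map φ =
          ((g⁻¹ : GL (Fin 3) F) : Matrix (Fin 3) (Fin 3) F) ∧
        orderOf g = q ^ 2 - q + 1 := by
  obtain ⟨p, k, hp, hk, rfl⟩ := hq
  have hpp : p.Prime := hp.nat_prime
  have : Fact p.Prime := ⟨hpp⟩
  have : CharP F p := by
    have : CharP F (ringChar F) := ringChar.charP F
    have hd : ringChar F ∣ p ^ (k * 2) := by
      have h : ((Fintype.card F : ℕ) : F) = 0 := Nat.cast_card_eq_zero F
      rw [hF, ← pow_mul] at h
      exact (ringChar.spec F _).mp h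
    have hr : (ringChar F).Prime := CharP.char_is_prime F _
    have := (Nat.prime_dvd_prime_iff_eq hr hpp).mp (hr.dvd_of_dvd_pow hd)
    rw [← this]; infer_instance
  let L := FiniteField.Extension F p 3
  have : CharP L p := charP_of_injective_algebraMap (algebraMap F L).injective p
  have h3 : Module.finrank F L = 3 := FiniteField.finrank_extension F p 3
  have hL : Nat.card L = ((p ^ k) ^ 2) ^ 3 := by
    rw [← hF, ← Nat.card_eq_fintype_card]; exact FiniteField.natCard_extension F p 3
  let σ : L →+* L := iterateFrobenius L p (k * 3)
  have hσd : ∀ x : L, σ x = x ^ ((p ^ k) ^ 3) := by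
    intro x; rw [← pow_mul]; exact iterateFrobenius_def ..
  let τ : L →+* L := iterateFrobenius L p (k * 2)
  have hτd : ∀ x : L, τ x = x ^ ((p ^ k) ^ 2) := by
    intro x; rw [← pow_mul]; exact iterateFrobenius_def ..
  clear_value σ τ
  obtain ⟨ζ, hζ⟩ := aux_zeta (L := L) (p ^ k) hq2 hL
  exact aux_main p (p ^ k) hq2 hF h3 φ hφ σ τ hσd hτd ζ hζ
end
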